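/- Let n ≥ 2, p ≥ 1 and λ ∈ (1, ∞), and set λ' = λ/(λ−1). Then for every nonzero nonnegative continuous function f : ℝⁿ → ℝ with compact support, ‖f‖₁^{n+λ'p} ≤ 2^{−n} b_{n,p,λ} ‖f‖_λ^{λ'p} ( ∫_{S^{n−1}} ( ∫_{ℝⁿ} f(x) |⟨x,ξ⟩|^p dx )^{−n/p} dξ )^{−p}. -/

import Mathlib

open MeasureTheory Real
open scoped RealInnerProductSpace

/-- The constant `R_{n,p}` from the Haberl–Schuster asymmetric `L_p` Blaschke–Santaló
inequality: the value of the sharp bound, attained for the Euclidean ball. -/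
noncomputable def Rnp (n : ℕ) (p : ℝ) : ℝ :=
  Real.pi ^ ((n : ℝ) / (2 * p) + n) / (Real.Gamma (((n : ℝ) + 2) / 2)) ^ (2 : ℕ) *
    (2 * Real.Gamma (((n : ℝ) + p + 2) / 2) /
      (Real.Gamma (((n : ℝ) + 2) / 2) * Real.Gamma ((p + 1) / 2))) ^ ((n : ℝ) / p)

/-- The constant `a_{n,p,λ}` for `λ > 1`, with `λ' = λ/(λ-1)`; here
`B(m,l) = Γ(m)Γ(l)/Γ(m+l)` is the Beta function. -/
noncomputable def anpl (n : ℕ) (p lam : ℝ) : ℝ :=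
  (((n : ℝ) / p) * ((n : ℝ) / ((lam / (lam - 1)) * p) + 1) ^ (lam / (lam - 1) - 1) *
      ((lam / (lam - 1)) * p / (n : ℝ) + 1) ^ ((n : ℝ) / p) *
      (Real.Gamma ((n : ℝ) / p) * Real.Gamma (lam / (lam - 1)) /
        Real.Gamma ((n : ℝ) / p + lam / (lam - 1)))) ^ p

/-- The constant `b_{n,p,λ} = (n/(n+p))^n a_{n,p,λ} R_{n,p}^p n^p` for `λ > 1`. -/
noncomputable def bnpl (n : ℕ) (p lam : ℝ) : ℝ :=
  ((n : ℝ) / ((n : ℝ) + p)) ^ (n : ℝ) * anpl n p lam * Rnp n p ^ p * (n : ℝ) ^ p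

section BlaschkeSantalo

open scoped ENNReal Pointwise

open Module

set_option linter.unusedSectionVars false

/-- The midpoint Prékopa–Leindler inequality on `V`, in squared form. -/
def MidpointPrekopaLeindler (V : Type*) [AddCommGroup V] [Module ℝ V] [MeasureSpace V] : Prop :=
  ∀ f g h : V → ℝ≥0∞, Measurable f → Measurable g → Measurable h →
    (∀ x y, f x * g y ≤ h ((1 / 2 : ℝ) • (x + y)) ^ 2) →
    (∫⁻ x, f x) * (∫⁻ x, g x) ≤ (∫⁻ x, h x) ^ 2

theorem ENNReal.four_mul_mul_le_add_sq (a b : ℝ≥0∞) : 4 * (a * b) ≤ (a + b) ^ 2 := by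
  rcases eq_or_ne a ⊤ with rfl | ha
  · simp
  rcases eq_or_ne b ⊤ with rfl | hb
  · simp
  lift a to NNReal using ha
  lift b to NNReal using hb
  norm_cast
  rw [← NNReal.coe_le_coe]
  push_cast
  nlinarith [sq_nonneg ((a : ℝ) - b)]

/-- One-dimensional Brunn–Minkowski inequality for compact sets. -/
theorem IsCompact.volume_add_volume_le {K L C : Set ℝ} (hK : IsCompact K) (hL : IsCompact L)
    (hK0 : K.Nonempty) (hL0 : L.Nonempty)
    (h : ∀ a ∈ K, ∀ b ∈ L, a + b ∈ C) : volume K + volume L ≤ volume C := by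
  obtain ⟨a, ha, hamax⟩ := hK.exists_isGreatest hK0
  obtain ⟨b, hb, hbmin⟩ := hL.exists_isLeast hL0
  have h1 : volume ((fun x => x + b) '' K) = volume K := by
    simp [Set.image_add_right]
  have h2 : volume ((fun x => a + x) '' L) = volume L := by
    simp [Set.image_add_left]
  have hd : AEDisjoint volume ((fun x => x + b) '' K) ((fun x => a + x) '' L) := by
    refine measure_mono_null (t := {a + b}) ?_ (by simp)
    rintro _ ⟨⟨x, hx, rfl⟩, ⟨y, hy, hxy⟩⟩
    have := hamax hx
    have := hbmin hy
    simp only [Set.mem_singleton_iff] at *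
    linarith
  rw [← h1, ← h2, ← measure_union₀ _ hd]
  · apply measure_mono
    rintro _ (⟨x, hx, rfl⟩ | ⟨x, hx, rfl⟩)
    · exact h _ hx _ hb
    · exact h _ ha _ hx
  · exact (hL.image (by fun_prop)).measurableSet.nullMeasurableSet

/-- One-dimensional Brunn–Minkowski inequality for measurable sets. -/
theorem MeasurableSet.volume_add_volume_le {A B C : Set ℝ} (hA : MeasurableSet A)
    (hB : MeasurableSet B) (hA0 : A.Nonempty) (hB0 : B.Nonempty)
    (h : ∀ a ∈ A, ∀ b ∈ B, a + b ∈ C) : volume A + volume B ≤ volume C := by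
  obtain ⟨a, ha⟩ := hA0
  obtain ⟨b, hb⟩ := hB0
  rw [hA.measure_eq_iSup_isCompact, hB.measure_eq_iSup_isCompact]
  simp only [iSup_and']
  refine ENNReal.biSup_add_biSup_le' (p := fun K => K ⊆ A ∧ IsCompact K)
    (q := fun K => K ⊆ B ∧ IsCompact K) ⟨∅, by simp⟩ ⟨∅, by simp⟩ ?_
  rintro K ⟨hKA, hK⟩ L ⟨hLB, hL⟩
  refine (add_le_add (measure_mono (Set.subset_insert a K))
    (measure_mono (Set.subset_insert b L))).trans ?_
  refine (hK.insert a).volume_add_volume_le (hL.insert b) (Set.insert_nonempty _ _)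
    (Set.insert_nonempty _ _) ?_
  intro x hx y hy
  exact h x (Set.insert_subset ha hKA hx) y (Set.insert_subset hb hLB hy)

theorem lintegral_add_lintegral_le_of_mul_le_sq {f g h : ℝ → ℝ} (hf : Measurable f)
    (hg : Measurable g) (hh : Measurable h) (hf0 : ∀ x, 0 ≤ f x) (hg0 : ∀ x, 0 ≤ g x)
    (hh0 : ∀ x, 0 ≤ h x) (hf1 : ∀ x, f x ≤ 1) (hg1 : ∀ x, g x ≤ 1)
    (hfs : ∀ t < 1, ∃ x, t < f x) (hgs : ∀ t < 1, ∃ x, t < g x)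
    (H : ∀ x y, f x * g y ≤ h ((1 / 2 : ℝ) * (x + y)) ^ 2) :
    (∫⁻ x, ENNReal.ofReal (f x)) + (∫⁻ x, ENNReal.ofReal (g x)) ≤
      2 * ∫⁻ x, ENNReal.ofReal (h x) := by
  rw [lintegral_eq_lintegral_meas_lt _ (.of_forall hf0) hf.aemeasurable,
    lintegral_eq_lintegral_meas_lt _ (.of_forall hg0) hg.aemeasurable,
    lintegral_eq_lintegral_meas_lt _ (.of_forall hh0) hh.aemeasurable]
  have anti : ∀ φ : ℝ → ℝ, Measurable fun t : ℝ => volume {a : ℝ | t < φ a} := fun φ =>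
    Antitone.measurable fun s t hst => measure_mono fun x hx => lt_of_le_of_lt hst hx
  rw [← lintegral_add_left (anti f), ← lintegral_const_mul _ (anti h)]
  refine setLIntegral_mono ((anti h).const_mul _) fun t ht => ?_
  rcases lt_or_ge t 1 with ht1 | ht1
  · have : 2 * volume {a : ℝ | t < h a} = volume ((fun x => (1 / 2 : ℝ) * x) ⁻¹' {a | t < h a}) := by
      rw [Real.volume_preimage_mul_left (by norm_num)]
      norm_num
    rw [this]
    refine MeasurableSet.volume_add_volume_le (measurableSet_lt measurable_const hf)
      (measurableSet_lt measurable_const hg) (hfs t ht1) (hgs t ht1) ?_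
    intro a ha b hb
    have ht0 : 0 < t := ht
    have h1 : t ^ 2 < h ((1 / 2 : ℝ) * (a + b)) ^ 2 := by
      refine lt_of_lt_of_le ?_ (H a b)
      have ha' : t < f a := ha
      have hb' : t < g b := hb
      nlinarith
    exact lt_of_pow_lt_pow_left₀ 2 (hh0 _) h1
  · have e1 : {a : ℝ | t < f a} = ∅ := by
      ext x; simpa using (hf1 x).trans ht1
    have e2 : {a : ℝ | t < g a} = ∅ := by
      ext x; simpa using (hg1 x).trans ht1
    simp [e1, e2]

theorem lintegral_mul_lintegral_le_sq_of_bounded {f g h : ℝ → ℝ≥0∞} (hf : Measurable f)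
    (hg : Measurable g) (hh : Measurable h) (hfb : ⨆ x, f x ≠ ⊤) (hgb : ⨆ x, g x ≠ ⊤)
    (H : ∀ x y, f x * g y ≤ h ((1 / 2 : ℝ) • (x + y)) ^ 2) :
    (∫⁻ x, f x) * (∫⁻ x, g x) ≤ (∫⁻ x, h x) ^ 2 := by
  have hfM : ∀ x, f x ≤ ⨆ x, f x := le_iSup f
  have hgN : ∀ x, g x ≤ ⨆ x, g x := le_iSup g
  have hfs' : ∀ c < ⨆ x, f x, ∃ x, c < f x := fun c hc => lt_iSup_iff.1 hc
  have hgs' : ∀ c < ⨆ x, g x, ∃ x, c < g x := fun c hc => lt_iSup_iff.1 hc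
  generalize (⨆ x, f x) = M at *
  generalize (⨆ x, g x) = N at *
  rcases eq_or_ne M 0 with rfl | hM0
  · have : ∀ x, f x = 0 := fun x => le_antisymm (hfM x) bot_le
    simp [this]
  rcases eq_or_ne N 0 with rfl | hN0
  · have : ∀ x, g x = 0 := fun x => le_antisymm (hgN x) bot_le
    simp [this]
  lift M to NNReal using hfb
  lift N to NNReal using hgb
  have hM : 0 < M := by simpa [pos_iff_ne_zero] using hM0
  have hN : 0 < N := by simpa [pos_iff_ne_zero] using hN0
  have hftop : ∀ x, f x ≠ ⊤ := fun x => ((hfM x).trans_lt ENNReal.coe_lt_top).ne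
  have hgtop : ∀ x, g x ≠ ⊤ := fun x => ((hgN x).trans_lt ENNReal.coe_lt_top).ne
  obtain ⟨K, hK⟩ : ∃ K : NNReal, K ^ 2 = M * N := ⟨NNReal.sqrt (M * N), by simp⟩
  have hK0 : 0 < K := by
    rw [pos_iff_ne_zero]; rintro rfl
    have := mul_pos hM hN
    simp at hK; grind
  lift f to ℝ → NNReal using hftop
  lift g to ℝ → NNReal using hgtop
  have hhtop : ∀ x, min (h x) K ≠ ⊤ := fun x => by simp
  obtain ⟨k, hk⟩ : ∃ k : ℝ → NNReal, (fun x => (k x : ℝ≥0∞)) = fun x => min (h x) K := by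
    refine ⟨fun x => (min (h x) K).toNNReal, ?_⟩
    ext x; simp
  have hk' : ∀ x, (k x : ℝ≥0∞) = min (h x) K := fun x => congrFun hk x
  have hkm : Measurable k := by
    have : Measurable fun x => (k x : ℝ≥0∞) := by rw [hk]; exact hh.min measurable_const
    simpa using this.ennreal_toNNReal
  have hfm : Measurable f := by simpa using hf.ennreal_toNNReal
  have hgm : Measurable g := by simpa using hg.ennreal_toNNReal
  have hfM' : ∀ x, f x ≤ M := fun x => ENNReal.coe_le_coe.1 (hfM x)
  have hgN' : ∀ x, g x ≤ N := fun x => ENNReal.coe_le_coe.1 (hgN x)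
  have hsup : ∀ (φ : ℝ → NNReal) (Q : NNReal), 0 < Q →
      (∀ c < (Q : ℝ≥0∞), ∃ x, c < (φ x : ℝ≥0∞)) → ∀ t < (1 : ℝ), ∃ x, t < ((φ x / Q : NNReal) : ℝ) := by
    intro φ Q hQ hφ t ht
    rcases lt_or_ge t 0 with h0 | h0
    · exact ⟨0, h0.trans_le (NNReal.coe_nonneg _)⟩
    · lift t to NNReal using h0
      obtain ⟨x, hx⟩ := hφ (t * Q : NNReal) (by
        norm_cast
        have : t < 1 := by exact_mod_cast ht
        exact mul_lt_of_lt_one_left hQ this)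
      refine ⟨x, ?_⟩
      norm_cast at hx ⊢
      rwa [lt_div_iff₀ hQ]
  have main := lintegral_add_lintegral_le_of_mul_le_sq (f := fun x => ((f x / M : NNReal) : ℝ))
    (g := fun x => ((g x / N : NNReal) : ℝ)) (h := fun x => ((k x / K : NNReal) : ℝ))
    (by fun_prop) (by fun_prop) (by fun_prop) (fun _ => NNReal.coe_nonneg _)
    (fun _ => NNReal.coe_nonneg _) (fun _ => NNReal.coe_nonneg _)
    (fun x => by exact_mod_cast div_le_one_of_le₀ (hfM' x) bot_le)
    (fun x => by exact_mod_cast div_le_one_of_le₀ (hgN' x) bot_le)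
    (hsup f M hM hfs') (hsup g N hN hgs') (by
      intro x y
      norm_cast
      rw [div_mul_div_comm, div_pow, hK]
      gcongr
      have h1 := H x y
      have h2 : (f x : ℝ≥0∞) * g y ≤ (k ((1 / 2 : ℝ) * (x + y)) : ℝ≥0∞) ^ 2 := by
        rw [hk']
        rcases min_choice (h ((1 / 2 : ℝ) * (x + y))) K with hc | hc
        · rw [hc]; exact h1
        · rw [hc]
          norm_cast
          rw [hK]
          exact mul_le_mul' (hfM' x) (hgN' y)
      exact_mod_cast h2)
  have conv : ∀ (φ : ℝ → NNReal) (Q : NNReal), Measurable φ → 0 < Q →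
      ∫⁻ x, ENNReal.ofReal ((φ x / Q : NNReal) : ℝ) = (Q : ℝ≥0∞)⁻¹ * ∫⁻ x, φ x := by
    intro φ Q hφ hQ
    rw [← lintegral_const_mul _ (by fun_prop)]
    congr 1 with x
    rw [ENNReal.ofReal_coe_nnreal, ENNReal.coe_div hQ.ne', mul_comm, div_eq_mul_inv]
  rw [conv f M hfm hM, conv g N hgm hN, conv k K hkm hK0] at main
  have hkh : ∫⁻ x, (k x : ℝ≥0∞) ≤ ∫⁻ x, h x := lintegral_mono fun x => by
    rw [hk']; exact min_le_left _ _
  have h3 := (ENNReal.four_mul_mul_le_add_sq _ _).trans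
    (pow_le_pow_left₀ bot_le (main.trans (mul_le_mul_right (mul_le_mul_right hkh _) _)) 2)
  generalize (∫⁻ x, (f x : ℝ≥0∞)) = a at *
  generalize (∫⁻ x, (g x : ℝ≥0∞)) = b at *
  generalize (∫⁻ x, h x) = c at *
  have hKK : (K : ℝ≥0∞) ^ 2 = M * N := by exact_mod_cast hK
  have e1 : 4 * ((M : ℝ≥0∞)⁻¹ * a * ((N : ℝ≥0∞)⁻¹ * b)) = (4 * (K : ℝ≥0∞)⁻¹ ^ 2) * (a * b) := by
    rw [← ENNReal.inv_pow, hKK, ENNReal.mul_inv (by simp) (by simp)]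
    ring
  have e2 : (2 * ((K : ℝ≥0∞)⁻¹ * c)) ^ 2 = (4 * (K : ℝ≥0∞)⁻¹ ^ 2) * c ^ 2 := by ring
  rw [e1, e2] at h3
  have hKne : (K : ℝ≥0∞)⁻¹ ≠ 0 := by simp
  have hKtop : (K : ℝ≥0∞)⁻¹ ≠ ⊤ := by simpa using hK0.ne'
  refine (ENNReal.mul_le_mul_iff_right ?_ ?_).1 h3
  · exact mul_ne_zero (by norm_num) (pow_ne_zero _ hKne)
  · exact ENNReal.mul_ne_top (by norm_num) (ENNReal.pow_ne_top hKtop)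

theorem ENNReal.iSup_min_natCast (a : ℝ≥0∞) : ⨆ k : ℕ, min a k = a := by
  rw [← inf_iSup_eq, ENNReal.iSup_natCast]
  simp

theorem midpointPrekopaLeindler_real : MidpointPrekopaLeindler ℝ := by
  intro f g h hf hg hh H
  have key : ∀ φ : ℝ → ℝ≥0∞, Measurable φ →
      ∫⁻ x, φ x = ⨆ k : ℕ, ∫⁻ x, min (φ x) k := by
    intro φ hφ
    rw [← lintegral_iSup (fun k => hφ.min measurable_const)]
    · simp_rw [ENNReal.iSup_min_natCast]
    · intro k l hkl x
      exact min_le_min le_rfl (by simpa using hkl)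
  rw [key f hf, key g hg, ENNReal.iSup_mul]
  refine iSup_le fun k => ?_
  rw [ENNReal.mul_iSup]
  refine iSup_le fun l => ?_
  have hb : ∀ (φ : ℝ → ℝ≥0∞) (k : ℕ), ⨆ x, min (φ x) (k : ℝ≥0∞) ≠ ⊤ := fun φ k =>
    ((iSup_le fun x => min_le_right _ _).trans_lt (ENNReal.natCast_lt_top k)).ne
  refine lintegral_mul_lintegral_le_sq_of_bounded (hf.min measurable_const)
    (hg.min measurable_const) hh (hb f k) (hb g l) fun x y => ?_
  exact (mul_le_mul' (min_le_left _ _) (min_le_left _ _)).trans (H x y)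

theorem MidpointPrekopaLeindler.prod {V W : Type*} [AddCommGroup V] [Module ℝ V] [MeasureSpace V]
    [AddCommGroup W] [Module ℝ W] [MeasureSpace W] [SFinite (volume : Measure V)]
    [SFinite (volume : Measure W)] (hV : MidpointPrekopaLeindler V)
    (hW : MidpointPrekopaLeindler W) : MidpointPrekopaLeindler (V × W) := by
  intro f g h hf hg hh H
  simp only [Measure.volume_eq_prod]
  rw [lintegral_prod _ hf.aemeasurable, lintegral_prod _ hg.aemeasurable,
    lintegral_prod _ hh.aemeasurable]
  refine hV _ _ _ hf.lintegral_prod_right' hg.lintegral_prod_right' hh.lintegral_prod_right' ?_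
  intro x y
  refine hW _ _ _ (hf.comp measurable_prodMk_left) (hg.comp measurable_prodMk_left)
    (hh.comp measurable_prodMk_left) ?_
  intro u v
  exact H (x, u) (y, v)

theorem MidpointPrekopaLeindler.of_measurePreserving {V W : Type*} [AddCommGroup V] [Module ℝ V]
    [MeasureSpace V] [AddCommGroup W] [Module ℝ W] [MeasureSpace W] (hV : MidpointPrekopaLeindler V)
    (L : V →ₗ[ℝ] W) (hL : MeasurePreserving L) : MidpointPrekopaLeindler W := by
  intro f g h hf hg hh H
  rw [← hL.lintegral_comp hf, ← hL.lintegral_comp hg, ← hL.lintegral_comp hh]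
  refine hV _ _ _ (hf.comp hL.measurable) (hg.comp hL.measurable) (hh.comp hL.measurable) ?_
  intro x y
  simpa using H (L x) (L y)

theorem midpointPrekopaLeindler_pi (m : ℕ) : MidpointPrekopaLeindler (Fin m → ℝ) := by
  induction m with
  | zero =>
    intro f g h _ _ _ H
    have h0 : ∀ φ : (Fin 0 → ℝ) → ℝ≥0∞, ∫⁻ x, φ x = φ 0 := fun φ => by
      rw [Measure.volume_pi_eq_dirac 0, lintegral_dirac]
    rw [h0, h0, h0]
    simpa only [Subsingleton.elim ((1 / 2 : ℝ) • ((0 : Fin 0 → ℝ) + 0)) 0] using H 0 0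
  | succ m ih =>
    refine (midpointPrekopaLeindler_real.prod ih).of_measurePreserving
      (Fin.consLinearEquiv ℝ (fun _ : Fin (m + 1) => ℝ)).toLinearMap ?_
    have e : ⇑(Fin.consLinearEquiv ℝ (fun _ : Fin (m + 1) => ℝ)).toLinearMap =
        ⇑(MeasurableEquiv.piFinSuccAbove (fun _ : Fin (m + 1) => ℝ) 0).symm := by
      ext x i
      simp [MeasurableEquiv.piFinSuccAbove, Fin.insertNthEquiv]
    rw [e]
    exact (volume_preserving_piFinSuccAbove (fun _ : Fin (m + 1) => ℝ) 0).symm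

theorem midpointPrekopaLeindler_innerProductSpace (V : Type*) [NormedAddCommGroup V]
    [InnerProductSpace ℝ V] [FiniteDimensional ℝ V] [MeasurableSpace V] [BorelSpace V] :
    MidpointPrekopaLeindler V := by
  refine ((midpointPrekopaLeindler_pi (Module.finrank ℝ V)).of_measurePreserving
    (WithLp.linearEquiv 2 ℝ (Fin (Module.finrank ℝ V) → ℝ)).symm.toLinearMap
    (PiLp.volume_preserving_toLp _)).of_measurePreserving
    (stdOrthonormalBasis ℝ V).repr.symm.toLinearEquiv.toLinearMap
    (stdOrthonormalBasis ℝ V).measurePreserving_repr_symm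

theorem integrable_mul_of_bounded_of_compact_support {X : Type*} [TopologicalSpace X]
    [MeasurableSpace X] [BorelSpace X] [T2Space X] {μ : Measure X} [IsFiniteMeasureOnCompacts μ]
    {f φ : X → ℝ} {K : Set X} (hK : IsCompact K) (hf : Measurable f) (hf1 : ∀ x, |f x| ≤ 1)
    (hfK : ∀ x, x ∉ K → f x = 0) (hφ : Continuous φ) : Integrable (fun x => f x * φ x) μ := by
  have h1 : IntegrableOn φ K μ := hφ.continuousOn.integrableOn_compact hK
  have h2 : IntegrableOn (fun x => f x * φ x) K μ :=
    Integrable.bdd_mul h1 hf.aestronglyMeasurable (.of_forall hf1)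
  refine (integrableOn_iff_integrable_of_support_subset ?_).1 h2
  intro x hx
  by_contra h
  exact hx (by simp [hfK x h])

theorem ConvexOn.le_of_even_of_abs_le {G : ℝ → ℝ} (hG : ConvexOn ℝ Set.univ G)
    (heven : ∀ u, G (-u) = G u) {u v : ℝ} (h : |u| ≤ |v|) : G u ≤ G v := by
  have h' := abs_le.1 h
  have hmem : u ∈ segment ℝ (-|v|) |v| := by
    rw [segment_eq_Icc (by linarith [abs_nonneg v])]; exact h'
  have := hG.le_on_segment (Set.mem_univ _) (Set.mem_univ _) hmem
  rw [heven, max_self] at this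
  rcases abs_choice v with hv | hv <;> rw [hv] at this
  · exact this
  · rwa [heven] at this

theorem convexOn_abs_rpow {p : ℝ} (hp : 1 ≤ p) : ConvexOn ℝ Set.univ fun u : ℝ => |u| ^ p := by
  refine ⟨convex_univ, fun x _ y _ a b ha hb hab => ?_⟩
  have h := (convexOn_rpow hp).2 (abs_nonneg x) (abs_nonneg y) ha hb hab
  refine le_trans (rpow_le_rpow (abs_nonneg _) ?_ (by linarith)) h
  simp only [smul_eq_mul]
  calc |a * x + b * y| ≤ |a * x| + |b * y| := abs_add_le _ _
    _ = a * |x| + b * |y| := by rw [abs_mul, abs_mul, abs_of_nonneg ha, abs_of_nonneg hb]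

/-- The indicator function of the interval `(-l, l)`. -/
noncomputable def centeredInterval (l t : ℝ) : ℝ := if |t| < l then 1 else 0

theorem centeredInterval_neg (l t : ℝ) : centeredInterval l (-t) = centeredInterval l t := by
  simp [centeredInterval]

theorem measurable_centeredInterval (l : ℝ) : Measurable (centeredInterval l) :=
  Measurable.ite (measurableSet_lt measurable_norm measurable_const) measurable_const
    measurable_const

theorem centeredInterval_nonneg (l t : ℝ) : 0 ≤ centeredInterval l t := by
  unfold centeredInterval; split_ifs <;> simp

theorem centeredInterval_le_one (l t : ℝ) : centeredInterval l t ≤ 1 := by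
  unfold centeredInterval; split_ifs <;> simp

theorem centeredInterval_eq_zero {l t : ℝ} (h : l ≤ |t|) : centeredInterval l t = 0 := by
  simp [centeredInterval, h]

theorem integral_centeredInterval {l : ℝ} (hl : 0 ≤ l) : ∫ t, centeredInterval l t = 2 * l := by
  have : centeredInterval l = Set.indicator (Set.Ioo (-l) l) 1 := by
    ext t
    simp [centeredInterval, Set.indicator_apply, abs_lt]
  rw [this, integral_indicator_one measurableSet_Ioo]
  simp [hl]; ring

theorem integrable_centeredInterval_mul (l : ℝ) {G : ℝ → ℝ} (hG : Continuous G) :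
    Integrable fun t => centeredInterval l t * G t := by
  refine integrable_mul_of_bounded_of_compact_support (isCompact_Icc (a := -l) (b := l))
    (measurable_centeredInterval l)
    (fun t => by rw [abs_of_nonneg (centeredInterval_nonneg _ _)]; exact centeredInterval_le_one _ _)
    (fun t ht => centeredInterval_eq_zero ?_) hG
  by_contra! h
  exact ht ⟨(abs_lt.1 h).1.le, (abs_lt.1 h).2.le⟩

/-- Bathtub principle on the line. -/
theorem integral_centeredInterval_mul_le {φ G : ℝ → ℝ} (hφ0 : ∀ t, 0 ≤ φ t)
    (hφ1 : ∀ t, φ t ≤ 1) (hφ : Integrable φ) (hG : Continuous G)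
    (hφG : Integrable fun t => φ t * G t) (hmono : ∀ u v, |u| ≤ |v| → G u ≤ G v) :
    ∫ t, centeredInterval ((∫ t, φ t) / 2) t * G t ≤ ∫ t, φ t * G t := by
  set l := (∫ t, φ t) / 2 with hl
  have hl0 : 0 ≤ l := by 
    have : 0 ≤ ∫ t, φ t := integral_nonneg hφ0
    positivity
  have hD := integrable_centeredInterval_mul l hG
  have hD1 : Integrable (centeredInterval l) := by
    simpa using integrable_centeredInterval_mul l (G := fun _ => 1) continuous_const
  have key : 0 ≤ ∫ t, (φ t - centeredInterval l t) * (G t - G l) := by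
    refine integral_nonneg fun t => ?_
    simp only [Pi.zero_apply, centeredInterval]
    split_ifs with h
    · have := hmono t l (by rw [abs_of_nonneg hl0]; exact h.le)
      nlinarith [hφ1 t]
    · have := hmono l t (by rw [abs_of_nonneg hl0]; linarith)
      nlinarith [hφ0 t]
  have e : ∫ t, (φ t - centeredInterval l t) * (G t - G l) =
      (∫ t, φ t * G t) - (∫ t, centeredInterval l t * G t) := by
    have : ∀ t, (φ t - centeredInterval l t) * (G t - G l) =
      (φ t * G t - centeredInterval l t * G t) - (φ t - centeredInterval l t) * G l := by
      intro t; ring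
    simp_rw [this]
    have h1 : Integrable fun t => φ t * G t - centeredInterval l t * G t := hφG.sub hD
    have h2 : Integrable fun t => (φ t - centeredInterval l t) * G l := (hφ.sub hD1).mul_const _
    rw [integral_sub h1 h2, integral_sub hφG hD,
      integral_mul_const, integral_sub hφ hD1, integral_centeredInterval hl0, hl]
    ring
  linarith

theorem two_mul_integral_centeredInterval_mul_abs_rpow_le {p : ℝ} (hp : 1 ≤ p) {φ : ℝ → ℝ}
    (hφm : Measurable φ) (hφ0 : ∀ t, 0 ≤ φ t) (hφ1 : ∀ t, φ t ≤ 1) {R : ℝ}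
    (hφR : ∀ t, R < |t| → φ t = 0) (a b s : ℝ) :
    2 * ∫ t, centeredInterval ((∫ t, φ t) / 2) t * |(a + b) / 2 + t * s| ^ p ≤
      (∫ t, φ t * |a + t * s| ^ p) + ∫ t, φ t * |b - t * s| ^ p := by
  have hp0 : 0 ≤ p := by linarith
  have h_integral : ∀ G : ℝ → ℝ, Continuous G → Integrable fun t => φ t * G t := fun G hG =>
    integrable_mul_of_bounded_of_compact_support (isCompact_Icc (a := -R) (b := R)) hφm
      (fun t => by rw [abs_of_nonneg (hφ0 t)]; exact hφ1 t)
      (fun t ht => hφR t (by by_contra! h; exact ht (abs_le.1 h))) hG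
  have hφi : Integrable φ := by simpa using h_integral (fun _ => 1) continuous_const
  have hc : ∀ c d : ℝ, Continuous fun t : ℝ => |c + t * d| ^ p := fun c d =>
    Continuous.rpow_const (by fun_prop) fun _ => Or.inr hp0
  have hc' : ∀ c d : ℝ, Continuous fun t : ℝ => |c - t * d| ^ p := fun c d =>
    Continuous.rpow_const (by fun_prop) fun _ => Or.inr hp0
  rw [← integral_add (h_integral _ (hc a s)) (h_integral _ (hc' b s))]
  obtain ⟨m, hm1⟩ : ∃ m : ℝ, s = 0 ∨ m * s = (b - a) / 2 := by
    rcases eq_or_ne s 0 with h | h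
    · exact ⟨0, Or.inl h⟩
    · exact ⟨(b - a) / 2 / s, Or.inr (by field_simp)⟩
  have hconv : ∀ c d : ℝ, ConvexOn ℝ Set.univ fun t : ℝ => |c + t * d| ^ p := fun c d => by
    have := (convexOn_abs_rpow hp).comp_affineMap (AffineMap.lineMap c (c + d))
    simpa [AffineMap.lineMap_apply, Function.comp_def, add_comm] using this
  set c := (a + b) / 2 with hcdef
  have hGc : Continuous fun t : ℝ => |c + t * s| ^ p + |c + t * -s| ^ p := (hc c s).add (hc c (-s))
  have B := integral_centeredInterval_mul_le (φ := fun t => φ (t + m))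
    (G := fun t => |c + t * s| ^ p + |c + t * -s| ^ p) (fun t => hφ0 _) (fun t => hφ1 _)
    (hφi.comp_add_right m) hGc
    (by
      have := (h_integral (fun t => |c + (t - m) * s| ^ p + |c + (t - m) * -s| ^ p)
        (hGc.comp (continuous_sub_right m))).comp_add_right m
      simpa using this)
    (fun u v huv => ((hconv c s).add (hconv c (-s))).le_of_even_of_abs_le
      (fun u => by simp [add_comm]) huv)
  rw [integral_add_right_eq_self φ m] at B
  set l := (∫ t, φ t) / 2
  have e1 : ∫ t, centeredInterval l t * (|c + t * s| ^ p + |c + t * -s| ^ p) =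
      2 * ∫ t, centeredInterval l t * |c + t * s| ^ p := by
    simp_rw [mul_add]
    rw [integral_add (integrable_centeredInterval_mul l (hc c s))
      (integrable_centeredInterval_mul l (hc c (-s))), two_mul]
    congr 1
    rw [← integral_neg_eq_self]
    simp [centeredInterval_neg]
  rw [e1] at B
  refine B.trans ?_
  rw [← integral_sub_right_eq_self _ m]
  refine (integral_mono_of_nonneg (.of_forall fun t => ?_)
    ((h_integral _ (hc a s)).add (h_integral _ (hc' b s))) (.of_forall fun t => ?_))
  · have := hφ0 (t - m + m)
    simp only [Pi.zero_apply]
    positivity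
  · simp only [sub_add_cancel]
    rw [← mul_add]
    refine mul_le_mul_of_nonneg_left ?_ (hφ0 t)
    rcases hm1 with rfl | hm1
    · have h1 := (convexOn_abs_rpow hp).2 (Set.mem_univ a) (Set.mem_univ b)
        (show (0 : ℝ) ≤ 1 / 2 by norm_num) (show (0 : ℝ) ≤ 1 / 2 by norm_num) (by norm_num)
      simp only [smul_eq_mul] at h1
      have : (1 / 2 : ℝ) * a + 1 / 2 * b = c := by rw [hcdef]; ring
      rw [this] at h1
      simp
      linarith
    · apply le_of_eq
      congr 3 <;> [skip; skip]
      · rw [hcdef]; linear_combination -hm1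
      · rw [hcdef]; linear_combination hm1

/-- Equality case of the bathtub principle for the second moment. -/
theorem ae_eq_centeredInterval_of_integral_sq_le {φ : ℝ → ℝ} (hφ0 : ∀ t, 0 ≤ φ t)
    (hφ1 : ∀ t, φ t ≤ 1) (hφ : Integrable φ) (hφG : Integrable fun t => φ t * t ^ 2)
    (h : ∫ t, φ t * t ^ 2 ≤ ∫ t, centeredInterval ((∫ t, φ t) / 2) t * t ^ 2) :
    φ =ᵐ[volume] centeredInterval ((∫ t, φ t) / 2) := by
  set l := (∫ t, φ t) / 2 with hl
  have hl0 : 0 ≤ l := by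
    have : 0 ≤ ∫ t, φ t := integral_nonneg hφ0
    positivity
  have hD := integrable_centeredInterval_mul l (G := fun t => t ^ 2) (by fun_prop)
  have hD1 : Integrable (centeredInterval l) := by
    simpa using integrable_centeredInterval_mul l (G := fun _ => 1) continuous_const
  have hnn : ∀ t, 0 ≤ (φ t - centeredInterval l t) * (t ^ 2 - l ^ 2) := by
    intro t
    simp only [centeredInterval]
    split_ifs with h
    · have : t ^ 2 ≤ l ^ 2 := sq_le_sq' (by linarith [(abs_lt.1 h).1]) (abs_lt.1 h).2.le
      nlinarith [hφ1 t]
    · have : l ^ 2 ≤ t ^ 2 := by rw [← sq_abs t]; exact pow_le_pow_left₀ hl0 (not_lt.1 h) 2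
      nlinarith [hφ0 t]
  have h1 : Integrable fun t => φ t * t ^ 2 - centeredInterval l t * t ^ 2 := hφG.sub hD
  have h2 : Integrable fun t => (φ t - centeredInterval l t) * l ^ 2 := (hφ.sub hD1).mul_const _
  have e0 : ∀ t, (φ t - centeredInterval l t) * (t ^ 2 - l ^ 2) =
      (φ t * t ^ 2 - centeredInterval l t * t ^ 2) - (φ t - centeredInterval l t) * l ^ 2 := by
    intro t; ring
  have e : ∫ t, (φ t - centeredInterval l t) * (t ^ 2 - l ^ 2) =
      (∫ t, φ t * t ^ 2) - (∫ t, centeredInterval l t * t ^ 2) := by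
    simp_rw [e0]
    rw [integral_sub h1 h2, integral_sub hφG hD,
      integral_mul_const, integral_sub hφ hD1, integral_centeredInterval hl0, hl]
    ring
  have hz : ∫ t, (φ t - centeredInterval l t) * (t ^ 2 - l ^ 2) = 0 :=
    le_antisymm (by rw [e]; linarith) (integral_nonneg hnn)
  have hi : Integrable fun t => (φ t - centeredInterval l t) * (t ^ 2 - l ^ 2) := by
    simp_rw [e0]; exact h1.sub h2
  have hae := (integral_eq_zero_iff_of_nonneg hnn hi).1 hz
  have hne : ∀ᵐ t : ℝ, t ∉ ({l, -l} : Set ℝ) :=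
    measure_eq_zero_iff_ae_notMem.1 ((Set.toFinite _).measure_zero _)
  filter_upwards [hae, hne] with t ht htl
  simp only [Set.mem_insert_iff, Set.mem_singleton_iff, not_or] at htl
  rcases mul_eq_zero.1 ht with h | h
  · linarith
  · rcases sq_eq_sq_iff_eq_or_eq_neg.1 (sub_eq_zero.1 h) with h | h
    · exact absurd h htl.1
    · exact absurd h htl.2

section Steiner

variable {F : Type*} [NormedAddCommGroup F] [InnerProductSpace ℝ F] [FiniteDimensional ℝ F]
  [MeasurableSpace F] [BorelSpace F]

/-- Measurable functions `F × ℝ → [0, 1]` vanishing outside the Euclidean ball of radius `R`. -/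
structure IsProdDensity (R : ℝ) (f : F × ℝ → ℝ) : Prop where
  measurable : Measurable f
  nonneg : ∀ q, 0 ≤ f q
  le_one : ∀ q, f q ≤ 1
  eq_zero : ∀ q : F × ℝ, R ^ 2 < ‖q.1‖ ^ 2 + q.2 ^ 2 → f q = 0

/-- Steiner symmetrization of a density in the direction of the second factor. -/
noncomputable def steiner (f : F × ℝ → ℝ) (q : F × ℝ) : ℝ :=
  centeredInterval ((∫ t, f (q.1, t)) / 2) q.2

/-- The `p`-th absolute moment of `f` in the direction `y`. -/
noncomputable def prodMoment (p : ℝ) (f : F × ℝ → ℝ) (y : F × ℝ) : ℝ :=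
  ∫ q, f q * |⟪q.1, y.1⟫ + q.2 * y.2| ^ p

namespace IsProdDensity

variable {R p : ℝ} {f : F × ℝ → ℝ}

theorem integrable_mul (hR : 0 ≤ R) (hf : IsProdDensity R f) {φ : F × ℝ → ℝ} (hφ : Continuous φ) :
    Integrable fun q => f q * φ q := by
  refine integrable_mul_of_bounded_of_compact_support
    (isCompact_closedBall (0 : F × ℝ) R) hf.measurable
    (fun q => by rw [abs_of_nonneg (hf.nonneg q)]; exact hf.le_one q) (fun q hq => hf.eq_zero q ?_) hφ
  rw [mem_closedBall_zero_iff, Prod.norm_def, max_le_iff, not_and_or, not_le, not_le,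
    Real.norm_eq_abs] at hq
  rcases hq with h | h
  · nlinarith [sq_nonneg q.2]
  · rw [← sq_abs q.2]; nlinarith [sq_nonneg ‖q.1‖]

theorem integrable (hR : 0 ≤ R) (hf : IsProdDensity R f) : Integrable f := by
  simpa using hf.integrable_mul hR (φ := fun _ => 1) continuous_const

theorem slice_eq_zero (hR : 0 ≤ R) (hf : IsProdDensity R f) (u : F) (t : ℝ) (ht : R < |t|) :
    f (u, t) = 0 := by
  refine hf.eq_zero _ ?_
  simp only
  rw [← sq_abs t]; nlinarith [sq_nonneg ‖u‖]

theorem slice_measurable (hf : IsProdDensity R f) (u : F) : Measurable fun t => f (u, t) :=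
  hf.measurable.comp measurable_prodMk_left

theorem slice_integrable_mul (hR : 0 ≤ R) (hf : IsProdDensity R f) (u : F) {G : ℝ → ℝ}
    (hG : Continuous G) : Integrable fun t => f (u, t) * G t :=
  integrable_mul_of_bounded_of_compact_support (isCompact_Icc (a := -R) (b := R))
    (hf.slice_measurable u)
    (fun t => by rw [abs_of_nonneg (hf.nonneg _)]; exact hf.le_one _)
    (fun t ht => hf.slice_eq_zero hR u t (by by_contra! h; exact ht (abs_le.1 h))) hG

theorem slice_integrable (hR : 0 ≤ R) (hf : IsProdDensity R f) (u : F) :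
    Integrable fun t => f (u, t) := by
  simpa using hf.slice_integrable_mul hR u (G := fun _ => 1) continuous_const

theorem slice_integral_nonneg (hf : IsProdDensity R f) (u : F) : 0 ≤ ∫ t, f (u, t) :=
  integral_nonneg fun _ => hf.nonneg _

theorem steiner (hf : IsProdDensity R f) : IsProdDensity R (steiner f) where
  measurable := by
    have h1 : Measurable fun u : F => ∫ t, f (u, t) :=
      (hf.measurable.stronglyMeasurable.integral_prod_right' (ν := volume)).measurable
    exact Measurable.ite (measurableSet_lt measurable_snd.norm ((h1.comp measurable_fst).div_const 2))
      measurable_const measurable_const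
  nonneg q := centeredInterval_nonneg _ _
  le_one q := centeredInterval_le_one _ _
  eq_zero q hq := by
    refine centeredInterval_eq_zero ?_
    have h1 : ∫ t, f (q.1, t) ≤ ∫ t, Set.indicator (Set.Icc (-|q.2|) |q.2|) (1 : ℝ → ℝ) t := by
      refine integral_mono_of_nonneg (.of_forall fun _ => hf.nonneg _)
        ((integrable_indicator_iff measurableSet_Icc).2 (by
          rw [Pi.one_def]
          exact integrableOn_const (by simp))) (.of_forall fun t => ?_)
      simp only [Set.indicator_apply, Pi.one_apply]
      split_ifs with ht
      · exact hf.le_one _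
      · refine (hf.eq_zero _ ?_).le
        have : |q.2| < |t| := by
          by_contra! h; exact ht (abs_le.1 h)
        have h2 : q.2 ^ 2 ≤ t ^ 2 := sq_le_sq.2 this.le
        simp only; linarith
    rw [integral_indicator_one measurableSet_Icc] at h1
    simp at h1
    linarith

theorem integral_steiner_slice (hf : IsProdDensity R f) (u : F) :
    ∫ t, _root_.steiner f (u, t) = ∫ t, f (u, t) := by
  have := integral_centeredInterval (l := (∫ t, f (u, t)) / 2)
    (by have := hf.slice_integral_nonneg u; positivity)
  simp only [_root_.steiner]
  rw [this]; ring

theorem integral_steiner (hR : 0 ≤ R) (hf : IsProdDensity R f) :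
    ∫ q, _root_.steiner f q = ∫ q, f q := by
  have h1 := (hf.steiner).integrable hR
  have h2 := hf.integrable hR
  rw [Measure.volume_eq_prod] at *
  rw [integral_prod _ h1, integral_prod _ h2]
  simp_rw [hf.integral_steiner_slice]

theorem slice_moment_sub (hR : 0 ≤ R) (hf : IsProdDensity R f) (u : F) :
    (∫ t, f (u, t) * (‖u‖ ^ 2 + t ^ 2)) - ∫ t, _root_.steiner f (u, t) * (‖u‖ ^ 2 + t ^ 2) =
      (∫ t, f (u, t) * t ^ 2) - ∫ t, _root_.steiner f (u, t) * t ^ 2 := by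
  have hs := hf.steiner
  simp_rw [mul_add]
  rw [integral_add ((hf.slice_integrable hR u).mul_const _)
      (hf.slice_integrable_mul hR u (by fun_prop)),
    integral_add ((hs.slice_integrable hR u).mul_const _)
      (hs.slice_integrable_mul hR u (by fun_prop)), integral_mul_const, integral_mul_const,
    hf.integral_steiner_slice]
  ring

theorem slice_moment_steiner_le (hR : 0 ≤ R) (hf : IsProdDensity R f) (u : F) :
    ∫ t, _root_.steiner f (u, t) * t ^ 2 ≤ ∫ t, f (u, t) * t ^ 2 :=
  integral_centeredInterval_mul_le (fun _ => hf.nonneg _) (fun _ => hf.le_one _)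
    (hf.slice_integrable hR u) (by fun_prop) (hf.slice_integrable_mul hR u (by fun_prop))
    (fun _ _ h => sq_le_sq.2 h)

theorem ae_eq_steiner (hR : 0 ≤ R) (hf : IsProdDensity R f)
    (h : ∫ q, f q * (‖q.1‖ ^ 2 + q.2 ^ 2) ≤ ∫ q, _root_.steiner f q * (‖q.1‖ ^ 2 + q.2 ^ 2)) :
    f =ᵐ[volume] _root_.steiner f := by
  have h1 := (hf.steiner).integrable_mul hR (φ := fun q => ‖q.1‖ ^ 2 + q.2 ^ 2) (by fun_prop)
  have h2 := hf.integrable_mul hR (φ := fun q => ‖q.1‖ ^ 2 + q.2 ^ 2) (by fun_prop)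
  rw [Measure.volume_eq_prod] at *
  rw [integral_prod _ h1, integral_prod _ h2] at h
  have hnn : ∀ u, 0 ≤ (∫ t, f (u, t) * (‖u‖ ^ 2 + t ^ 2)) -
      ∫ t, _root_.steiner f (u, t) * (‖u‖ ^ 2 + t ^ 2) := fun u => by
    rw [hf.slice_moment_sub hR u]
    exact sub_nonneg.2 (hf.slice_moment_steiner_le hR u)
  have hi := h2.integral_prod_left.sub h1.integral_prod_left
  have hz := (integral_eq_zero_iff_of_nonneg hnn hi).1 (le_antisymm (by
    rw [integral_sub h2.integral_prod_left h1.integral_prod_left]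
    simp only at *
    linarith) (integral_nonneg hnn))
  have hms : MeasurableSet {q : F × ℝ | f q = _root_.steiner f q} :=
    measurableSet_eq_fun hf.measurable (hf.steiner).measurable
  refine (Measure.ae_prod_iff_ae_ae hms).2 ?_
  filter_upwards [hz] with u hu
  refine ae_eq_centeredInterval_of_integral_sq_le (fun _ => hf.nonneg _) (fun _ => hf.le_one _)
    (hf.slice_integrable hR u) (hf.slice_integrable_mul hR u (by fun_prop)) ?_
  have e := hf.slice_moment_sub hR u
  simp only [Pi.zero_apply] at hu
  rw [hu] at e
  exact (sub_eq_zero.1 e.symm).le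

theorem prodMoment_steiner_le (hR : 0 ≤ R) (hf : IsProdDensity R f) (hp : 1 ≤ p) (v w : F) (s : ℝ) :
    2 * prodMoment p (_root_.steiner f) ((1 / 2 : ℝ) • (v + w), s) ≤
      prodMoment p f (v, s) + prodMoment p f (-w, s) := by
  have hc : ∀ y : F × ℝ, Continuous fun q : F × ℝ => |⟪q.1, y.1⟫ + q.2 * y.2| ^ p := fun y =>
    Continuous.rpow_const (by fun_prop) fun _ => Or.inr (by linarith)
  have h1 := (hf.steiner).integrable_mul hR (hc ((1 / 2 : ℝ) • (v + w), s))
  have h2 := hf.integrable_mul hR (hc (v, s))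
  have h3 := hf.integrable_mul hR (hc (-w, s))
  unfold prodMoment
  rw [Measure.volume_eq_prod] at *
  rw [integral_prod _ h1, integral_prod _ h2, integral_prod _ h3,
    ← integral_add h2.integral_prod_left h3.integral_prod_left, ← integral_const_mul]
  refine integral_mono (h1.integral_prod_left.const_mul 2)
    (h2.integral_prod_left.add h3.integral_prod_left) fun u => ?_
  have := two_mul_integral_centeredInterval_mul_abs_rpow_le hp (hf.slice_measurable u)
    (fun _ => hf.nonneg _) (fun _ => hf.le_one _) (hf.slice_eq_zero hR u) ⟪u, v⟫ ⟪u, w⟫ s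
  simp only [inner_smul_right, inner_add_right, inner_neg_right]
  convert this using 5
  · rfl
  · rfl
  · congr 2
    ring
  · rw [← abs_neg]
    congr 2
    ring

theorem measurable_prodMoment (hf : IsProdDensity R f) (hp : 1 ≤ p) :
    Measurable (prodMoment p f) := by
  have : StronglyMeasurable (Function.uncurry fun (y q : F × ℝ) =>
      f q * |⟪q.1, y.1⟫ + q.2 * y.2| ^ p) := by
    refine Measurable.stronglyMeasurable ?_
    refine (hf.measurable.comp measurable_snd).mul ?_
    refine Continuous.measurable (Continuous.rpow_const (by fun_prop) fun _ => Or.inr (by linarith))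
  exact (StronglyMeasurable.integral_prod_right this).measurable

/-- Steiner symmetrization does not decrease the volume of the polar `L_p` centroid body. -/
theorem volume_le_steiner (hR : 0 ≤ R) (hf : IsProdDensity R f) (hp : 1 ≤ p) :
    volume {y | prodMoment p f y ≤ 1} ≤ volume {y | prodMoment p (_root_.steiner f) y ≤ 1} := by
  have hm1 : MeasurableSet {y | prodMoment p f y ≤ 1} :=
    measurableSet_le (hf.measurable_prodMoment hp) measurable_const
  have hm2 : MeasurableSet {y | prodMoment p (_root_.steiner f) y ≤ 1} :=
    measurableSet_le ((hf.steiner).measurable_prodMoment hp) measurable_const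
  rw [Measure.volume_eq_prod, Measure.prod_apply_symm hm1, Measure.prod_apply_symm hm2]
  refine lintegral_mono fun s => ?_
  set A := (fun x : F => (x, s)) ⁻¹' {y | prodMoment p f y ≤ 1}
  set C := (fun x : F => (x, s)) ⁻¹' {y | prodMoment p (_root_.steiner f) y ≤ 1}
  have hA : MeasurableSet A := measurable_prodMk_right hm1
  have hC : MeasurableSet C := measurable_prodMk_right hm2
  have h := midpointPrekopaLeindler_innerProductSpace F (A.indicator 1) ((-A).indicator 1)
    (C.indicator 1) (measurable_one.indicator hA) (measurable_one.indicator hA.neg)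
    (measurable_one.indicator hC) (by
      intro v w
      by_cases hv : v ∈ A
      · by_cases hw : w ∈ -A
        · have : (1 / 2 : ℝ) • (v + w) ∈ C := by
            have h1 := hf.prodMoment_steiner_le hR hp v w s
            have h2 : prodMoment p f (v, s) ≤ 1 := hv
            have h3 : prodMoment p f (-w, s) ≤ 1 := hw
            change prodMoment p (_root_.steiner f) (_, s) ≤ 1
            linarith
          rw [Set.indicator_of_mem hv, Set.indicator_of_mem hw, Set.indicator_of_mem this]
          simp
        · simp [hw, -Set.mem_neg]
      · simp [hv])
  rw [lintegral_indicator_one hA, lintegral_indicator_one hA.neg, lintegral_indicator_one hC,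
    Measure.measure_neg, ← sq] at h
  exact (ENNReal.pow_le_pow_left_iff two_ne_zero).1 h

end IsProdDensity

end Steiner

section Density

open Filter Topology

variable {E : Type*} [NormedAddCommGroup E] [InnerProductSpace ℝ E] [FiniteDimensional ℝ E]
  [MeasurableSpace E] [BorelSpace E]

/-- Measurable functions `E → [0, 1]` vanishing outside the ball of radius `R`. -/
structure IsDensity (R : ℝ) (f : E → ℝ) : Prop where
  measurable : Measurable f
  nonneg : ∀ x, 0 ≤ f x
  le_one : ∀ x, f x ≤ 1
  eq_zero : ∀ x, R < ‖x‖ → f x = 0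

/-- The `p`-th absolute moment of `f` in the direction `y`. -/
noncomputable def absMoment (p : ℝ) (f : E → ℝ) (y : E) : ℝ := ∫ x, f x * |⟪x, y⟫| ^ p

/-- Orthogonal coordinates on `E` adapted to a unit vector `e`. -/
theorem exists_measurePreserving_orthogonal_coordinates (e : E) (he : ‖e‖ = 1) :
    ∃ Ψ : (ℝ ∙ e)ᗮ × ℝ ≃ᵐ E, MeasurePreserving Ψ ∧ ∀ q, Ψ q = (q.1 : E) + q.2 • e := by
  let T₀ : WithLp 2 ((ℝ ∙ e)ᗮ × ℝ) →ₗ[ℝ] E :=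
    { toFun := fun q => (q.fst : E) + q.snd • e
      map_add' := fun a b => by simp [add_smul]; abel
      map_smul' := fun c a => by simp [mul_smul] }
  have hT₀ : ∀ q, ‖T₀ q‖ = ‖q‖ := fun q => by
    have h0 : ⟪(q.fst : E), e⟫ = 0 := Submodule.mem_orthogonal_singleton_iff_inner_left.1 q.fst.2
    have h1 : ‖T₀ q‖ ^ 2 = ‖q‖ ^ 2 := by
      rw [WithLp.prod_norm_sq_eq_of_L2]
      change ‖(q.fst : E) + q.snd • e‖ ^ 2 = _
      rw [norm_add_sq_real, inner_smul_right, h0, norm_smul, he]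
      simp
    exact (sq_eq_sq₀ (norm_nonneg _) (norm_nonneg _)).1 h1
  have hfr : Module.finrank ℝ (WithLp 2 ((ℝ ∙ e)ᗮ × ℝ)) = Module.finrank ℝ E := by
    rw [(WithLp.linearEquiv 2 ℝ ((ℝ ∙ e)ᗮ × ℝ)).finrank_eq, Module.finrank_prod,
      ← Submodule.finrank_add_finrank_orthogonal (ℝ ∙ e),
      finrank_span_singleton (by rintro rfl; simp at he), Module.finrank_self, add_comm]
  let T : WithLp 2 ((ℝ ∙ e)ᗮ × ℝ) ≃ₗᵢ[ℝ] E :=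
    LinearIsometry.toLinearIsometryEquiv ⟨T₀, hT₀⟩ hfr
  refine ⟨(MeasurableEquiv.toLp 2 _).trans T.toHomeomorph.toMeasurableEquiv, ?_, fun q => rfl⟩
  exact T.measurePreserving.comp (WithLp.volume_preserving_toLp _ _)

namespace IsDensity

variable {R p : ℝ} {f : E → ℝ}

theorem integrable_mul (hf : IsDensity R f) {φ : E → ℝ} (hφ : Continuous φ) :
    Integrable fun x => f x * φ x :=
  integrable_mul_of_bounded_of_compact_support (isCompact_closedBall (0 : E) R) hf.measurable
    (fun q => by rw [abs_of_nonneg (hf.nonneg q)]; exact hf.le_one q)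
    (fun x hx => hf.eq_zero x (by simpa using hx)) hφ

theorem integrable (hf : IsDensity R f) : Integrable f := by
  simpa using hf.integrable_mul (φ := fun _ => 1) continuous_const

/-- Steiner symmetrization of a density along a unit vector. -/
theorem exists_symmetrization (hR : 0 ≤ R) (hf : IsDensity R f) (hp : 1 ≤ p) (e : E)
    (he : ‖e‖ = 1) :
    ∃ g : E → ℝ, IsDensity R g ∧ ∫ x, g x = ∫ x, f x ∧
      volume {y | absMoment p f y ≤ 1} ≤ volume {y | absMoment p g y ≤ 1} ∧
      (∫ x, f x * ‖x‖ ^ 2 ≤ ∫ x, g x * ‖x‖ ^ 2 → f =ᵐ[volume] g) ∧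
      ∀ x (c : ℝ), ‖x‖ < ‖x + c • e‖ → 0 < g (x + c • e) → g x = 1 := by
  obtain ⟨Ψ, hΨ, hΨe⟩ := exists_measurePreserving_orthogonal_coordinates e he
  have horth : ∀ u : (ℝ ∙ e)ᗮ, ⟪(u : E), e⟫ = 0 := fun u =>
    Submodule.mem_orthogonal_singleton_iff_inner_left.1 u.2
  have horth' : ∀ u : (ℝ ∙ e)ᗮ, ⟪e, (u : E)⟫ = 0 := fun u => by rw [real_inner_comm]; exact horth u
  have hinner : ∀ q r, ⟪Ψ q, Ψ r⟫ = ⟪q.1, r.1⟫ + q.2 * r.2 := fun q r => by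
    rw [hΨe, hΨe, inner_add_left, inner_add_right, inner_add_right, inner_smul_left,
      inner_smul_right, inner_smul_left, inner_smul_right, horth, horth',
      real_inner_self_eq_norm_sq, he]
    simp
  have hnorm : ∀ q, ‖Ψ q‖ ^ 2 = ‖q.1‖ ^ 2 + q.2 ^ 2 := fun q => by
    rw [← real_inner_self_eq_norm_sq, hinner, real_inner_self_eq_norm_sq, sq q.2]
  have h_integral : ∀ h : E → ℝ, ∫ q, h (Ψ q) = ∫ x, h x := fun h =>
    hΨ.integral_comp Ψ.measurableEmbedding h
  set F : (ℝ ∙ e)ᗮ × ℝ → ℝ := fun q => f (Ψ q) with hF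
  have hFd : IsProdDensity R F := by
    refine ⟨hf.measurable.comp Ψ.measurable, fun q => hf.nonneg _, fun q => hf.le_one _, ?_⟩
    intro q hq
    rw [← hnorm] at hq
    exact hf.eq_zero _ (lt_of_pow_lt_pow_left₀ 2 (norm_nonneg _) hq)
  set g : E → ℝ := fun x => steiner F (Ψ.symm x) with hg
  have hgΨ : ∀ q, g (Ψ q) = steiner F q := fun q => by simp [hg]
  have hmom : ∀ h : E → ℝ, volume {y | absMoment p h y ≤ 1} =
      volume {r | prodMoment p (fun q => h (Ψ q)) r ≤ 1} := fun h => by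
    rw [← hΨ.measure_preimage_equiv]
    congr 1
    ext r
    simp only [Set.mem_preimage, Set.mem_ofPred_eq, absMoment, prodMoment]
    rw [← h_integral]
    simp_rw [hinner]
  refine ⟨g, ⟨hFd.steiner.measurable.comp Ψ.symm.measurable, fun x => hFd.steiner.nonneg _,
    fun x => hFd.steiner.le_one _, fun x hx => hFd.steiner.eq_zero _ ?_⟩, ?_, ?_, ?_, ?_⟩
  · rw [← hnorm, MeasurableEquiv.apply_symm_apply]
    exact pow_lt_pow_left₀ hx hR two_ne_zero
  · rw [← h_integral g, ← h_integral f]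
    simp_rw [hgΨ]
    exact hFd.integral_steiner hR
  · rw [hmom, hmom]
    simp_rw [hgΨ]
    exact hFd.volume_le_steiner hR hp
  · intro h
    rw [← h_integral, ← h_integral fun x => g x * ‖x‖ ^ 2] at h
    simp_rw [hgΨ, hnorm] at h
    have := hFd.ae_eq_steiner hR h
    have h2 := hΨ.symm.quasiMeasurePreserving.ae this
    filter_upwards [h2] with x hx
    simpa [hF] using hx
  · intro x c hx hgx
    obtain ⟨q, rfl⟩ := Ψ.surjective x
    have hxc : Ψ q + c • e = Ψ (q.1, q.2 + c) := by rw [hΨe, hΨe, add_smul, add_assoc]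
    rw [hxc] at hx hgx
    rw [hgΨ] at hgx ⊢
    have h3 : |q.2| < |q.2 + c| := by
      have := pow_lt_pow_left₀ hx (norm_nonneg _) two_ne_zero
      rw [hnorm, hnorm] at this
      exact sq_lt_sq.1 (by simpa using this)
    simp only [steiner, centeredInterval] at hgx ⊢
    split_ifs at hgx with h4
    · exact if_pos (h3.trans h4)
    · exact absurd hgx (lt_irrefl _)

theorem exists_subseq_tendsto {f : ℕ → E → ℝ} (hf : ∀ k, IsDensity R (f k)) :
    ∃ (φ : ℕ → ℕ) (g : E → ℝ), StrictMono φ ∧ IsDensity R g ∧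
      ∀ ψ : E → ℝ, Continuous ψ →
        Tendsto (fun k => ∫ x, f (φ k) x * ψ x) atTop (𝓝 (∫ x, g x * ψ x)) := by
  set K := Metric.closedBall (0 : E) R
  set μ : Measure E := volume.restrict K
  have hK : IsCompact K := isCompact_closedBall 0 R
  have : IsFiniteMeasure μ := ⟨by simpa [μ] using hK.measure_lt_top⟩
  have habs : ∀ k x, ‖f k x‖ ≤ 1 := fun k x => by
    rw [Real.norm_eq_abs, abs_of_nonneg ((hf k).nonneg x)]; exact (hf k).le_one x
  have hmem : ∀ k, MemLp (f k) 2 μ := fun k =>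
    MemLp.of_bound (hf k).measurable.aestronglyMeasurable 1 (.of_forall (habs k))
  let u : ℕ → Lp ℝ 2 μ := fun k => (hmem k).toLp
  obtain ⟨C, hC⟩ : ∃ C, ∀ k, ‖u k‖ ≤ C := by
    refine ⟨_, fun k => Lp.norm_le_of_ae_bound (C := 1) zero_le_one ?_⟩
    filter_upwards [(hmem k).coeFn_toLp] with x hx
    rw [hx]; exact habs k x
  let Λ : ℕ → WeakDual ℝ (Lp ℝ 2 μ) := fun k =>
    StrongDual.toWeakDual (InnerProductSpace.toDual ℝ (Lp ℝ 2 μ) (u k))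
  have : Fact ((2 : ℝ≥0∞) ≠ ⊤) := ⟨by norm_num⟩
  obtain ⟨L, -, φ, hφ, hL⟩ := WeakDual.isSeqCompact_closedBall ℝ (Lp ℝ 2 μ) 0 C (x := Λ) (by
    intro k
    simp only [Set.mem_preimage, mem_closedBall_zero_iff]
    exact ((InnerProductSpace.toDual ℝ (Lp ℝ 2 μ)).norm_map (u k)).trans_le (hC k))
  set v : Lp ℝ 2 μ := (InnerProductSpace.toDual ℝ (Lp ℝ 2 μ)).symm (WeakDual.toStrongDual L)
  have hlim : ∀ w : E → ℝ, MemLp w 2 μ →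
      Tendsto (fun k => ∫ x, f (φ k) x * w x ∂μ) atTop (𝓝 (∫ x, v x * w x ∂μ)) := by
    intro w hw
    have h1 : Tendsto (fun k => Λ (φ k) hw.toLp) atTop (𝓝 (L hw.toLp)) :=
      ((WeakDual.eval_continuous (𝕜 := ℝ) (E := Lp ℝ 2 μ) hw.toLp).tendsto L).comp hL
    have h2 : L hw.toLp = ∫ x, v x * w x ∂μ := by
      have : L hw.toLp = ⟪v, hw.toLp⟫ := by
        rw [InnerProductSpace.toDual_symm_apply]; rfl
      rw [this, L2.inner_def]
      refine integral_congr_ae ?_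
      filter_upwards [hw.coeFn_toLp] with x hx
      rw [hx]; simp [mul_comm]
    have h3 : ∀ k, Λ k hw.toLp = ∫ x, f k x * w x ∂μ := fun k => by
      have : Λ k hw.toLp = ⟪u k, hw.toLp⟫ := rfl
      rw [this, L2.inner_def]
      refine integral_congr_ae ?_
      filter_upwards [hw.coeFn_toLp, (hmem k).coeFn_toLp] with x hx hx'
      rw [hx, hx']; simp [mul_comm]
    rw [← h2]
    simpa [Function.comp_def, h3] using h1
  have hvi : Integrable v μ := (Lp.memLp v).integrable (by norm_num)
  have hfi : ∀ k, Integrable (f k) μ := fun k => (hmem k).integrable (by norm_num)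
  have hset : ∀ s, MeasurableSet s →
      Tendsto (fun k => ∫ x in s, f (φ k) x ∂μ) atTop (𝓝 (∫ x in s, v x ∂μ)) := by
    intro s hs
    have h := hlim (s.indicator fun _ => 1) (memLp_indicator_const 2 hs 1 (Or.inr (measure_ne_top _ _)))
    have e : ∀ h : E → ℝ, ∫ x, h x * s.indicator (fun _ => 1) x ∂μ = ∫ x in s, h x ∂μ := fun h => by
      rw [← integral_indicator hs]
      congr 1 with x
      by_cases hx : x ∈ s <;> simp [hx]
    simpa only [e] using h
  have hv0 : 0 ≤ᵐ[μ] v := ae_nonneg_of_forall_setIntegral_nonneg hvi fun s hs _ =>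
    ge_of_tendsto' (hset s hs) fun k => integral_nonneg fun x => (hf _).nonneg x
  have hv1 : v ≤ᵐ[μ] fun _ => 1 := ae_le_of_forall_setIntegral_le hvi (integrable_const 1)
    fun s hs _ => le_of_tendsto' (hset s hs) fun k =>
      integral_mono (hfi _).integrableOn (integrable_const 1) fun x => (hf _).le_one x
  refine ⟨φ, K.indicator fun x => min 1 (max 0 (v x)), hφ, ⟨?_, ?_, ?_, ?_⟩, ?_⟩
  · exact (measurable_const.min (measurable_const.max (Lp.stronglyMeasurable v).measurable)).indicator
      hK.measurableSet
  · exact fun x => Set.indicator_nonneg (fun x _ => by positivity) x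
  · exact fun x => Set.indicator_le' (fun x _ => min_le_left _ _) (fun _ _ => zero_le_one) x
  · intro x hx
    exact Set.indicator_of_notMem (by simpa [K] using hx) _
  · intro ψ hψ
    obtain ⟨M, hM⟩ := hK.exists_bound_of_continuousOn hψ.continuousOn
    have hψm : MemLp ψ 2 μ := MemLp.of_bound hψ.aestronglyMeasurable M
      ((ae_restrict_iff' hK.measurableSet).2 (.of_forall hM))
    have h1 : ∀ k, ∫ x, f k x * ψ x = ∫ x, f k x * ψ x ∂μ := fun k => by
      refine (setIntegral_eq_integral_of_forall_compl_eq_zero fun x hx => ?_).symm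
      rw [(hf k).eq_zero x (by simpa [K] using hx), zero_mul]
    have h2 : ∫ x, K.indicator (fun x => min 1 (max 0 (v x))) x * ψ x = ∫ x, v x * ψ x ∂μ := by
      rw [← setIntegral_eq_integral_of_forall_compl_eq_zero (s := K) (fun x hx => by simp [hx])]
      refine integral_congr_ae ?_
      filter_upwards [hv0, hv1, ae_restrict_mem hK.measurableSet] with x h0 h1 hx
      simp only [Set.indicator_of_mem hx]
      rw [max_eq_right (show (0 : ℝ) ≤ v x from h0), min_eq_right h1]
    rw [h2]
    simp_rw [h1]
    exact hlim ψ hψm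

end IsDensity

end Density

section BusemannPetty

open Filter Topology

variable {E : Type*} [NormedAddCommGroup E] [InnerProductSpace ℝ E] [FiniteDimensional ℝ E]
  [MeasurableSpace E] [BorelSpace E]

theorem continuous_abs_inner_rpow {p : ℝ} (hp : 0 ≤ p) (y : E) :
    Continuous fun x : E => |⟪x, y⟫| ^ p :=
  (continuous_id.inner continuous_const).abs.rpow_const fun _ => Or.inr hp

theorem measurable_absMoment {f : E → ℝ} (hf : Measurable f) (p : ℝ) :
    Measurable (absMoment p f) := by
  have : StronglyMeasurable fun q : E × E => f q.2 * |⟪q.2, q.1⟫| ^ p := by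
    refine Measurable.stronglyMeasurable ?_
    have h : Measurable fun q : E × E => ⟪q.2, q.1⟫ :=
      (continuous_snd.inner continuous_fst).measurable
    have h' : Measurable fun q : E × E => |⟪q.2, q.1⟫| := measurable_abs.comp h
    exact (hf.comp measurable_snd).mul (h'.pow_const p)
  exact this.integral_prod_right.measurable

theorem absMoment_nonneg {f : E → ℝ} (hf : ∀ x, 0 ≤ f x) (p : ℝ) (y : E) :
    0 ≤ absMoment p f y :=
  integral_nonneg fun x => mul_nonneg (hf x) (by positivity)

theorem absMoment_smul (p : ℝ) (f : E → ℝ) (c : ℝ) (y : E) :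
    absMoment p f (c • y) = |c| ^ p * absMoment p f y := by
  simp only [absMoment]
  rw [← integral_const_mul]
  congr 1 with x
  rw [inner_smul_right, abs_mul, mul_rpow (abs_nonneg _) (abs_nonneg _)]
  ring

theorem absMoment_congr_ae {f g : E → ℝ} (h : f =ᵐ[volume] g) (p : ℝ) :
    absMoment p f = absMoment p g := by
  ext y
  refine integral_congr_ae ?_
  filter_upwards [h] with x hx
  rw [hx]

theorem isClosed_slab (R δ : ℝ) (v : E) : IsClosed {x : E | ‖x‖ ≤ R ∧ |⟪x, v⟫| ≤ δ} :=
  IsClosed.and (isClosed_le continuous_norm continuous_const)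
    (isClosed_le (by fun_prop) continuous_const)

theorem volume_slab_eq (R δ : ℝ) {v w : E} (h : ‖v‖ = ‖w‖) :
    volume {x : E | ‖x‖ ≤ R ∧ |⟪x, v⟫| ≤ δ} = volume {x : E | ‖x‖ ≤ R ∧ |⟪x, w⟫| ≤ δ} := by
  let ρ := (ℝ ∙ (v - w))ᗮ.reflection
  have hρ : MeasurePreserving ρ.toHomeomorph.toMeasurableEquiv (volume : Measure E) volume :=
    ρ.measurePreserving
  rw [← hρ.measure_preimage_equiv]
  congr 1
  ext x
  change ‖ρ x‖ ≤ R ∧ |⟪ρ x, v⟫| ≤ δ ↔ ‖x‖ ≤ R ∧ |⟪x, w⟫| ≤ δ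
  rw [LinearIsometryEquiv.norm_map, LinearIsometryEquiv.inner_map_eq_flip,
    Submodule.reflection_symm, Submodule.reflection_sub h]

theorem exists_volume_slab_le (R : ℝ) {e : E} (he : ‖e‖ = 1) {ε : ℝ≥0∞} (hε : 0 < ε) :
    ∃ δ > 0, volume {x : E | ‖x‖ ≤ R ∧ |⟪x, e⟫| ≤ δ} ≤ ε := by
  have ht := tendsto_measure_biInter_gt (μ := (volume : Measure E)) (a := (0 : ℝ))
    (s := fun δ => {x : E | ‖x‖ ≤ R ∧ |⟪x, e⟫| ≤ δ})
    (fun δ _ => (isClosed_slab R δ e).measurableSet.nullMeasurableSet)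
    (fun i j _ hij x hx => ⟨hx.1, hx.2.trans hij⟩)
    ⟨1, zero_lt_one, ((measure_mono fun x hx => by simpa using hx.1).trans_lt
      (isCompact_closedBall (0 : E) R).measure_lt_top).ne⟩
  have h0 : volume (⋂ r, ⋂ (_ : r > (0 : ℝ)), {x : E | ‖x‖ ≤ R ∧ |⟪x, e⟫| ≤ r}) = 0 := by
    refine measure_mono_null (t := ((ℝ ∙ e)ᗮ : Submodule ℝ E)) (fun x hx => ?_)
      (Measure.addHaar_submodule _ _ fun h => ?_)
    · simp only [Set.mem_iInter] at hx
      rw [SetLike.mem_coe, Submodule.mem_orthogonal_singleton_iff_inner_left]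
      exact abs_nonpos_iff.1 (le_of_forall_gt_imp_ge_of_dense fun r hr => (hx r hr).2)
    · have : e ∈ (ℝ ∙ e)ᗮ := h ▸ Submodule.mem_top
      rw [Submodule.mem_orthogonal_singleton_iff_inner_left, real_inner_self_eq_norm_sq, he] at this
      norm_num at this
  rw [h0] at ht
  obtain ⟨δ, h1, h2⟩ := ((ht.eventually (eventually_le_nhds hε)).and
    self_mem_nhdsWithin).exists
  exact ⟨δ, h2, h1⟩

namespace IsDensity

variable {R p : ℝ} {f : E → ℝ}

theorem exists_mul_norm_rpow_le_absMoment (hp : 0 < p) (R : ℝ) {A : ℝ} (hA : 0 < A) :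
    ∃ c > 0, ∀ f : E → ℝ, IsDensity R f → ∫ x, f x = A → ∀ y, c * ‖y‖ ^ p ≤ absMoment p f y := by
  by_cases hE : ∃ e : E, ‖e‖ = 1
  swap
  · refine ⟨1, one_pos, fun f hf _ y => ?_⟩
    have : y = 0 := by
      by_contra hy
      exact hE ⟨‖y‖⁻¹ • y, norm_smul_inv_norm hy⟩
    rw [this, norm_zero, zero_rpow hp.ne', mul_zero]
    exact absMoment_nonneg hf.nonneg _ _
  obtain ⟨e, he⟩ := hE
  obtain ⟨δ, hδ, hvol⟩ := exists_volume_slab_le R he (ε := ENNReal.ofReal (A / 2)) (by simpa)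
  have key : ∀ f : E → ℝ, IsDensity R f → ∫ x, f x = A → ∀ ξ : E, ‖ξ‖ = 1 →
      δ ^ p * (A / 2) ≤ absMoment p f ξ := by
    intro f hf hfA ξ hξ
    set s := {x : E | ‖x‖ ≤ R ∧ |⟪x, ξ⟫| ≤ δ}
    have hs : IsClosed s := isClosed_slab R δ ξ
    have hsv : volume s ≤ ENNReal.ofReal (A / 2) :=
      (volume_slab_eq R δ (hξ.trans he.symm)).trans_le hvol
    have hδp : 0 < δ ^ p := rpow_pos_of_pos hδ p
    have hi := hf.integrable_mul (continuous_abs_inner_rpow hp.le ξ)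
    have hsi : Integrable (s.indicator fun _ => (1 : ℝ)) :=
      (integrable_indicator_iff hs.measurableSet).2
        (integrableOn_const (hsv.trans_lt ENNReal.ofReal_lt_top).ne)
    have h1 : ∫ x, f x ≤ ∫ x, (s.indicator (fun _ => (1 : ℝ)) x +
        (δ ^ p)⁻¹ * (f x * |⟪x, ξ⟫| ^ p)) := by
      refine integral_mono hf.integrable (hsi.add (hi.const_mul _)) fun x => ?_
      have hfx := hf.nonneg x
      have h0 : 0 ≤ (δ ^ p)⁻¹ * (f x * |⟪x, ξ⟫| ^ p) := by positivity
      by_cases hx : x ∈ s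
      · simp only [Set.indicator_of_mem hx]
        linarith [hf.le_one x]
      · simp only [Set.indicator_of_notMem hx, zero_add]
        rcases lt_or_ge R ‖x‖ with h | h
        · rwa [hf.eq_zero x h] at h0 ⊢
        · have h3 : δ ≤ |⟪x, ξ⟫| := le_of_not_ge fun h' => hx ⟨h, h'⟩
          rw [inv_mul_eq_div, le_div_iff₀ hδp]
          exact mul_le_mul_of_nonneg_left (rpow_le_rpow hδ.le h3 hp.le) hfx
    rw [integral_add hsi (hi.const_mul _), integral_const_mul, hfA,
      integral_indicator_const _ hs.measurableSet] at h1
    have h2 : volume.real s ≤ A / 2 := ENNReal.toReal_le_of_le_ofReal (by positivity) hsv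
    have h3 : A / 2 ≤ (δ ^ p)⁻¹ * absMoment p f ξ := by
      simp only [smul_eq_mul, mul_one] at h1
      change A ≤ volume.real s + (δ ^ p)⁻¹ * absMoment p f ξ at h1
      linarith
    rwa [inv_mul_eq_div, le_div_iff₀ hδp, mul_comm] at h3
  refine ⟨δ ^ p * (A / 2), by positivity, fun f hf hfA y => ?_⟩
  rcases eq_or_ne y 0 with rfl | hy
  · rw [norm_zero, zero_rpow hp.ne', mul_zero]
    exact absMoment_nonneg hf.nonneg _ _
  · have h1 : y = ‖y‖ • (‖y‖⁻¹ • y) := by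
      rw [smul_smul, mul_inv_cancel₀ (norm_ne_zero_iff.2 hy), one_smul]
    conv_rhs => rw [h1]
    rw [absMoment_smul, abs_norm, mul_comm]
    exact mul_le_mul_of_nonneg_left (key f hf hfA _ (norm_smul_inv_norm hy)) (by positivity)

theorem exists_sublevel_subset_closedBall (hp : 0 < p) (R : ℝ) {A : ℝ} (hA : 0 < A) :
    ∃ ρ, ∀ f : E → ℝ, IsDensity R f → ∫ x, f x = A →
      {y | absMoment p f y ≤ 1} ⊆ Metric.closedBall 0 ρ := by
  obtain ⟨c, hc, h⟩ := exists_mul_norm_rpow_le_absMoment (E := E) hp R hA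
  refine ⟨c⁻¹ ^ p⁻¹, fun f hf hfA y hy => ?_⟩
  have h1 : ‖y‖ ^ p ≤ c⁻¹ := by
    simpa using (le_inv_mul_iff₀ hc).2 ((h f hf hfA y).trans hy)
  rw [mem_closedBall_zero_iff]
  have := rpow_le_rpow (by positivity) h1 (inv_nonneg.2 hp.le)
  rwa [rpow_rpow_inv (norm_nonneg _) hp.ne'] at this

theorem le_volume_of_tendsto (hp : 0 < p) {f : ℕ → E → ℝ} (hf : ∀ k, IsDensity R (f k)) {A : ℝ}
    (hA : 0 < A) (hfA : ∀ k, ∫ x, f k x = A) {g : E → ℝ}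
    (hlim : ∀ ψ : E → ℝ, Continuous ψ →
      Tendsto (fun k => ∫ x, f k x * ψ x) atTop (𝓝 (∫ x, g x * ψ x)))
    {V : ℝ≥0∞} (hV : ∀ k, V ≤ volume {y | absMoment p (f k) y ≤ 1}) :
    V ≤ volume {y | absMoment p g y ≤ 1} := by
  obtain ⟨ρ, hρ⟩ := exists_sublevel_subset_closedBall (E := E) hp R hA
  set S : ℕ → Set E := fun k => {y | absMoment p (f k) y ≤ 1}
  have hS : ∀ k, MeasurableSet (S k) := fun k =>
    measurableSet_le (measurable_absMoment (hf k).measurable p) measurable_const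
  set T : ℕ → Set E := fun k => ⋃ j ≥ k, S j
  have hT : ∀ k, MeasurableSet (T k) := fun k =>
    MeasurableSet.iUnion fun j => MeasurableSet.iUnion fun _ => hS j
  have hTa : Antitone T := fun i j hij => Set.biUnion_mono (fun _ h => hij.trans h) fun _ _ => le_rfl
  have hTρ : T 0 ⊆ Metric.closedBall 0 ρ :=
    Set.iUnion₂_subset fun j _ => hρ (f j) (hf j) (hfA j)
  have ht := tendsto_measure_iInter_atTop (μ := (volume : Measure E))
    (fun k => (hT k).nullMeasurableSet) hTa
    ⟨0, ((measure_mono hTρ).trans_lt (isCompact_closedBall (0 : E) ρ).measure_lt_top).ne⟩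
  refine (ge_of_tendsto' ht fun k => (hV k).trans (measure_mono ?_)).trans (measure_mono ?_)
  · exact Set.subset_biUnion_of_mem (u := S) (le_refl k)
  · intro y hy
    simp only [T, Set.mem_iInter, Set.mem_iUnion] at hy
    have h := hlim _ (continuous_abs_inner_rpow hp.le y)
    refine le_of_tendsto_of_frequently h (frequently_atTop.2 fun k => ?_)
    obtain ⟨j, hj, hjy⟩ := hy k
    exact ⟨j, hj, hjy⟩

end IsDensity

theorem exists_translate_inter_ne_zero {P Q : Set E} (hP : MeasurableSet P) (hQ : MeasurableSet Q)
    (hP0 : volume P ≠ 0) (hQ0 : volume Q ≠ 0) : ∃ z : E, volume {x | x ∈ P ∧ x + z ∈ Q} ≠ 0 := by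
  by_contra! h
  have hmp := measurePreserving_prod_add_swap (volume : Measure E) (volume : Measure E)
  have h1 := hmp.measure_preimage (hP.prod hQ).nullMeasurableSet
  rw [Measure.prod_prod, (Measure.measure_prod_null (hmp.measurable (hP.prod hQ))).2
    (.of_forall fun z => ?_)] at h1
  · exact mul_ne_zero hP0 hQ0 h1.symm
  · exact h z

/-- Among densities of given mass, the centred ball maximizes the volume of the polar moment body. -/
theorem IsDensity.volume_absMoment_le {R p r : ℝ} {f : E → ℝ} (hR : 0 ≤ R) (hp : 1 ≤ p)
    (hf : IsDensity R f) (hf0 : 0 < ∫ x, f x) (hr : volume.real (Metric.closedBall (0 : E) r) = ∫ x, f x) :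
    volume {y | absMoment p f y ≤ 1} ≤
      volume {y | absMoment p ((Metric.closedBall (0 : E) r).indicator fun _ => 1) y ≤ 1} := by
  have hp0 : 0 < p := one_pos.trans_le hp
  set 𝒞 : Set (E → ℝ) := {g | IsDensity R g ∧ ∫ x, g x = ∫ x, f x ∧
    volume {y | absMoment p f y ≤ 1} ≤ volume {y | absMoment p g y ≤ 1}} with h𝒞
  set I : (E → ℝ) → ℝ := fun g => ∫ x, g x * ‖x‖ ^ 2
  have hIc : Continuous fun x : E => ‖x‖ ^ 2 := by fun_prop
  have hbdd : BddBelow (I '' 𝒞) := ⟨0, by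
    rintro _ ⟨g, hg, rfl⟩
    exact integral_nonneg fun x => mul_nonneg (hg.1.nonneg x) (by positivity)⟩
  obtain ⟨g, hg, hgmin⟩ : ∃ g ∈ 𝒞, ∀ g' ∈ 𝒞, I g ≤ I g' := by
    obtain ⟨u, -, hu, huS⟩ := exists_seq_tendsto_sInf (S := I '' 𝒞) ⟨_, f, ⟨hf, rfl, le_rfl⟩, rfl⟩ hbdd
    choose F hF hFu using huS
    obtain ⟨φ, g, hφ, hg, hlim⟩ := IsDensity.exists_subseq_tendsto fun k => (hF k).1
    have hmass : ∫ x, g x = ∫ x, f x := by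
      have h := hlim (fun _ => 1) continuous_const
      simp only [mul_one, (hF _).2.1] at h
      exact tendsto_nhds_unique h tendsto_const_nhds |>.symm ▸ rfl
    refine ⟨g, ⟨hg, hmass, IsDensity.le_volume_of_tendsto hp0 (fun k => (hF (φ k)).1) hf0
      (fun k => (hF (φ k)).2.1) hlim fun k => (hF (φ k)).2.2⟩, fun g' hg' => ?_⟩
    have h1 : Tendsto (fun k => I (F (φ k))) atTop (𝓝 (I g)) := hlim _ hIc
    simp only [hFu] at h1
    rw [tendsto_nhds_unique h1 (hu.comp hφ.tendsto_atTop)]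
    exact csInf_le hbdd ⟨g', hg', rfl⟩
  set B := Metric.closedBall (0 : E) r
  have hB : MeasurableSet B := measurableSet_closedBall
  have hBi : Integrable (B.indicator fun _ => (1 : ℝ)) :=
    (integrable_indicator_iff hB).2 (integrableOn_const measure_closedBall_lt_top.ne)
  have hzero : ∫ x, (B.indicator (fun _ => (1 : ℝ)) x - g x) = 0 := by
    rw [integral_sub hBi hg.1.integrable, integral_indicator_const _ hB, hr, hg.2.1]
    simp
  set P := {x | x ∈ B ∧ g x < 1}
  set Q := {x | x ∉ B ∧ 0 < g x}
  have hP : MeasurableSet P := hB.inter (measurableSet_lt hg.1.measurable measurable_const)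
  have hQ : MeasurableSet Q := hB.compl.inter (measurableSet_lt measurable_const hg.1.measurable)
  suffices hae : g =ᵐ[volume] B.indicator fun _ => 1 by
    rw [← absMoment_congr_ae hae]
    exact hg.2.2
  by_cases hP0 : volume P = 0
  · have h1 : 0 ≤ᵐ[volume] fun x => g x - B.indicator (fun _ => (1 : ℝ)) x := by
      filter_upwards [measure_eq_zero_iff_ae_notMem.1 hP0] with x hx
      by_cases hxB : x ∈ B
      · simpa [hxB] using not_lt.1 fun h => hx ⟨hxB, h⟩
      · simpa [hxB] using hg.1.nonneg x
    have h2 := (integral_eq_zero_iff_of_nonneg_ae h1 (hg.1.integrable.sub hBi)).1 (by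
      rw [← neg_eq_zero, ← integral_neg]
      simpa using hzero)
    filter_upwards [h2] with x hx
    exact sub_eq_zero.1 hx
  by_cases hQ0 : volume Q = 0
  · have h1 : 0 ≤ᵐ[volume] fun x => B.indicator (fun _ => (1 : ℝ)) x - g x := by
      filter_upwards [measure_eq_zero_iff_ae_notMem.1 hQ0] with x hx
      by_cases hxB : x ∈ B
      · simpa [hxB] using hg.1.le_one x
      · simpa [hxB] using not_lt.1 fun h => hx ⟨hxB, h⟩
    have h2 := (integral_eq_zero_iff_of_nonneg_ae h1 (hBi.sub hg.1.integrable)).1 hzero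
    filter_upwards [h2] with x hx
    exact (sub_eq_zero.1 hx).symm
  exfalso
  obtain ⟨z, hz⟩ := exists_translate_inter_ne_zero hP hQ hP0 hQ0
  have hz0 : z ≠ 0 := by
    rintro rfl
    refine hz (measure_mono_null (fun x hx => ?_) measure_empty)
    simp only [add_zero] at hx
    exact hx.2.1 hx.1.1
  obtain ⟨g', hg', hmass, hvol, hmin, hsym⟩ :=
    hg.1.exists_symmetrization hR hp (‖z‖⁻¹ • z) (norm_smul_inv_norm hz0)
  have hae := hmin (hgmin g' ⟨hg', hmass.trans hg.2.1, hg.2.2.trans hvol⟩)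
  have hae' : ∀ᵐ x : E, g (x + z) = g' (x + z) :=
    (measurePreserving_add_right volume z).quasiMeasurePreserving.ae hae
  refine hz (measure_mono_null (fun x hx => ?_) (measure_union_null hae hae'))
  by_contra hcon
  simp only [Set.mem_union, Set.mem_compl_iff, Set.mem_ofPred_eq, not_or, not_not] at hcon
  obtain ⟨h1, h2⟩ := hcon
  have hzz : ‖z‖ • (‖z‖⁻¹ • z) = z := by
    rw [smul_smul, mul_inv_cancel₀ (norm_ne_zero_iff.2 hz0), one_smul]
  have h3 := hsym x ‖z‖
  rw [hzz] at h3
  have hxr : ‖x‖ ≤ r := by simpa [B] using hx.1.1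
  have hxz : r < ‖x + z‖ := by simpa [B] using hx.2.1
  have h4 := h3 (hxr.trans_lt hxz) (h2 ▸ hx.2.2)
  exact hx.1.2.ne (h1.trans h4)

end BusemannPetty

section LayerCake

open Filter Topology

/-- Change of variables for a function whose sublevel sets have power-law measure. -/
theorem lintegral_comp_of_measure_le {X : Type*} [MeasurableSpace X] {μ : Measure X} {N : X → ℝ}
    (hN : Measurable N) {a W : ℝ} (ha : 0 < a) (hW : 0 ≤ W)
    (h : ∀ u, 0 < u → μ {x | N x ≤ u} = ENNReal.ofReal (W * u ^ a)) {φ : ℝ → ℝ≥0∞}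
    (hφ : Measurable φ) :
    ∫⁻ x, φ (N x) ∂μ = ∫⁻ u in Set.Ioi 0, φ u * ENNReal.ofReal (W * a * u ^ (a - 1)) := by
  set d : ℝ → ℝ≥0∞ := fun u => ENNReal.ofReal (W * a * u ^ (a - 1)) with hd
  have hdm : Measurable d := by fun_prop
  set ν := (volume.restrict (Set.Ioi (0 : ℝ))).withDensity d
  have hIic : ∀ u, μ {x | N x ≤ u} = ENNReal.ofReal (W * max u 0 ^ a) := by
    have h0 : μ {x | N x ≤ 0} = 0 := by
      have ht : Tendsto (fun u : ℝ => ENNReal.ofReal (W * u ^ a)) (𝓝[>] 0) (𝓝 0) := by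
        have h1 : Tendsto (fun u : ℝ => W * u ^ a) (𝓝 0) (𝓝 (W * 0 ^ a)) :=
          ((continuous_id.rpow_const fun _ => Or.inr ha.le).const_mul W).tendsto 0
        rw [zero_rpow ha.ne', mul_zero] at h1
        simpa using (ENNReal.tendsto_ofReal h1).mono_left nhdsWithin_le_nhds
      refine le_antisymm (ge_of_tendsto ht ?_) zero_le
      filter_upwards [self_mem_nhdsWithin] with u hu
      rw [← h u hu]
      exact measure_mono fun x (hx : N x ≤ 0) => show N x ≤ u from hx.trans (le_of_lt hu)
    intro u
    rcases lt_or_ge 0 u with hu | hu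
    · rw [h u hu, max_eq_left hu.le]
    · rw [max_eq_right hu, zero_rpow ha.ne', mul_zero, ENNReal.ofReal_zero]
      exact measure_mono_null (fun x hx => le_trans hx hu) h0
  have hν : ∀ u v, 0 ≤ u → u ≤ v → ν (Set.Ioc u v) = ENNReal.ofReal (W * v ^ a - W * u ^ a) := by
    intro u v hu huv
    rw [withDensity_apply _ measurableSet_Ioc, Measure.restrict_restrict measurableSet_Ioc,
      Set.inter_eq_left.2 (show Set.Ioc u v ⊆ Set.Ioi 0 from fun x hx => hu.trans_lt hx.1)]
    have hi : IntegrableOn (fun x => W * a * x ^ (a - 1)) (Set.Ioc u v) := by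
      rw [← intervalIntegrable_iff_integrableOn_Ioc_of_le huv]
      exact (intervalIntegral.intervalIntegrable_rpow' (by linarith)).const_mul _
    rw [← ofReal_integral_eq_lintegral_ofReal hi ((ae_restrict_iff' measurableSet_Ioc).2
      (.of_forall fun x hx => ?_)), ← intervalIntegral.integral_of_le huv,
      intervalIntegral.integral_const_mul, integral_rpow (Or.inl (by linarith))]
    · congr 1
      rw [sub_add_cancel]
      field_simp
    · have : 0 < x := hu.trans_lt hx.1
      positivity
  have hmap : μ.map N = ν := by
    refine Measure.ext_of_Ioc' _ _ (fun u v _ => ?_) fun u v huv => ?_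
    · rw [Measure.map_apply hN measurableSet_Ioc]
      exact ((measure_mono fun x hx => hx.2).trans_lt
        ((hIic v).trans_lt ENNReal.ofReal_lt_top)).ne
    · rw [Measure.map_apply hN measurableSet_Ioc]
      have h1 : N ⁻¹' Set.Ioc u v = {x | N x ≤ v} \ {x | N x ≤ u} := by
        ext x; simp [and_comm]
      have h2 : {x | N x ≤ u} ⊆ {x | N x ≤ v} := fun x (hx : N x ≤ u) =>
        show N x ≤ v from hx.trans huv.le
      rw [h1, measure_sdiff h2 (measurableSet_le hN measurable_const).nullMeasurableSet
        ((hIic u).trans_lt ENNReal.ofReal_lt_top).ne, hIic, hIic,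
        ← ENNReal.ofReal_sub _ (by positivity), ← hν _ _ (le_max_right _ _) (max_le_max_right _ huv.le)]
      have h2 : ∀ s : Set ℝ, MeasurableSet s → ν s = ν (s ∩ Set.Ioi 0) := fun s hs => by
        rw [withDensity_apply _ hs, withDensity_apply _ (hs.inter measurableSet_Ioi),
          Measure.restrict_restrict hs, Measure.restrict_restrict (hs.inter measurableSet_Ioi),
          Set.inter_assoc, Set.inter_self]
      rw [h2 _ measurableSet_Ioc, h2 (Set.Ioc u v) measurableSet_Ioc]
      congr 1
      ext x
      simp only [Set.mem_inter_iff, Set.mem_Ioc, Set.mem_Ioi, max_lt_iff, le_max_iff]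
      constructor
      · rintro ⟨⟨⟨h1, h2⟩, h3⟩, h4⟩
        exact ⟨⟨h1, h3.resolve_right (not_le.2 h4)⟩, h4⟩
      · rintro ⟨⟨h1, h2⟩, h3⟩
        exact ⟨⟨⟨h1, h3⟩, Or.inl h2⟩, h3⟩
  rw [← lintegral_map hφ hN, hmap, lintegral_withDensity_eq_lintegral_mul _ hdm hφ]
  exact lintegral_congr fun u => mul_comm _ _

theorem lintegral_one_sub_rpow {X : Type*} [MeasurableSpace X] {μ : Measure X} {N : X → ℝ}
    (hN : Measurable N) {a W q : ℝ} (ha : 0 < a) (hW : 0 ≤ W) (hq : 0 < q)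
    (h : ∀ u, 0 < u → μ {x | N x ≤ u} = ENNReal.ofReal (W * u ^ a)) :
    ∫⁻ x, ENNReal.ofReal (max 0 (1 - N x) ^ q) ∂μ =
      ENNReal.ofReal (W * (a * ProbabilityTheory.beta a (q + 1))) := by
  have hφ : Measurable fun u : ℝ => ENNReal.ofReal (max 0 (1 - u) ^ q) := by fun_prop
  rw [lintegral_comp_of_measure_le hN ha hW h hφ]
  have hβ := ProbabilityTheory.beta_pos ha (show 0 < q + 1 by linarith)
  have h1 := ProbabilityTheory.lintegral_betaPDF_eq_one ha (show 0 < q + 1 by linarith)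
  have hm : Measurable (ProbabilityTheory.betaPDF a (q + 1)) :=
    (ProbabilityTheory.measurable_betaPDFReal _ _).ennreal_ofReal
  rw [← mul_one (ENNReal.ofReal _), ← h1, ← lintegral_const_mul _ hm,
    ← lintegral_indicator measurableSet_Ioi]
  refine lintegral_congr fun u => ?_
  by_cases hu : 0 < u
  · rw [Set.indicator_of_mem (Set.mem_Ioi.2 hu)]
    rcases lt_or_ge u 1 with hu1 | hu1
    · rw [ProbabilityTheory.betaPDF_of_pos_lt_one hu hu1, max_eq_right (by linarith),
        ← ENNReal.ofReal_mul (by have : 0 ≤ 1 - u := by linarith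
                                 positivity), ← ENNReal.ofReal_mul (by positivity)]
      congr 1
      rw [add_sub_cancel_right]
      field_simp
    · rw [ProbabilityTheory.betaPDF_eq_zero_of_one_le hu1, max_eq_left (by linarith),
        zero_rpow hq.ne']
      simp
  · rw [Set.indicator_of_notMem (by simpa using hu),
      ProbabilityTheory.betaPDF_eq_zero_of_nonpos (not_lt.1 hu), mul_zero]

theorem lintegral_sub_rpow {X : Type*} [MeasurableSpace X] {μ : Measure X} {N : X → ℝ}
    (hN : Measurable N) {a W q s : ℝ} (ha : 0 < a) (hW : 0 ≤ W) (hq : 0 < q)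
    (hs : 0 < s) (h : ∀ u, 0 < u → μ {x | N x ≤ u} = ENNReal.ofReal (W * u ^ a)) :
    ∫⁻ x, ENNReal.ofReal (max 0 (s - N x) ^ q) ∂μ =
      ENNReal.ofReal (W * (a * ProbabilityTheory.beta a (q + 1)) * s ^ (q + a)) := by
  have h1 := lintegral_one_sub_rpow (μ := μ) (hN.div_const s) ha (W := W * s ^ a) (by positivity) hq fun u hu => by
      rw [mul_assoc, ← mul_rpow hs.le hu.le, ← h _ (mul_pos hs hu)]
      simp_rw [div_le_iff₀ hs, mul_comm u s]
  have h2 : ∀ x, ENNReal.ofReal (max 0 (s - N x) ^ q) =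
      ENNReal.ofReal (s ^ q) * ENNReal.ofReal (max 0 (1 - N x / s) ^ q) := fun x => by
    rw [← ENNReal.ofReal_mul (by positivity), ← mul_rpow hs.le (le_max_left _ _),
      mul_max_of_nonneg _ _ hs.le, mul_zero, mul_sub, mul_one, mul_div_cancel₀ _ hs.ne']
  simp_rw [h2]
  rw [lintegral_const_mul _ (by fun_prop), h1, ← ENNReal.ofReal_mul (by positivity)]
  congr 1
  rw [rpow_add hs]
  ring

theorem setLIntegral_of_measure_le {X : Type*} [MeasurableSpace X] {μ : Measure X} {N : X → ℝ}
    (hN : Measurable N) {a W : ℝ} (ha : 0 < a) (hW : 0 ≤ W)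
    (h : ∀ u, 0 < u → μ {x | N x ≤ u} = ENNReal.ofReal (W * u ^ a)) :
    ∫⁻ x in {x | N x ≤ 1}, ENNReal.ofReal (N x) ∂μ = ENNReal.ofReal (W * (a / (a + 1))) := by
  have hφ : Measurable ((Set.Iic (1 : ℝ)).indicator ENNReal.ofReal) :=
    ENNReal.measurable_ofReal.indicator measurableSet_Iic
  have h1 := lintegral_comp_of_measure_le hN ha hW h hφ
  rw [← lintegral_indicator (measurableSet_le hN measurable_const)]
  refine Eq.trans (lintegral_congr fun x => ?_) (h1.trans ?_)
  · by_cases hx : N x ≤ 1 <;> simp [hx]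
  · have h2 : ∀ u : ℝ, (Set.Iic (1 : ℝ)).indicator ENNReal.ofReal u *
        ENNReal.ofReal (W * a * u ^ (a - 1)) = (Set.Iic (1 : ℝ)).indicator
          (fun u => ENNReal.ofReal u * ENNReal.ofReal (W * a * u ^ (a - 1))) u := fun u => by
      by_cases hu : u ∈ Set.Iic (1 : ℝ) <;> simp [hu]
    simp_rw [h2]
    rw [setLIntegral_indicator measurableSet_Iic, Set.inter_comm, Set.Ioi_inter_Iic]
    have h3 : ∀ u ∈ Set.Ioc (0 : ℝ) 1, ENNReal.ofReal u * ENNReal.ofReal (W * a * u ^ (a - 1)) =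
        ENNReal.ofReal (W * a * u ^ a) := fun u hu => by
      rw [← ENNReal.ofReal_mul hu.1.le]
      congr 1
      rw [rpow_sub_one hu.1.ne']
      field_simp [hu.1.ne']
    rw [setLIntegral_congr_fun measurableSet_Ioc h3, ← ofReal_integral_eq_lintegral_ofReal,
      ← intervalIntegral.integral_of_le zero_le_one, intervalIntegral.integral_const_mul,
      integral_rpow (Or.inl (by linarith)), zero_rpow (by positivity), one_rpow]
    · congr 1
      ring
    · rw [← IntegrableOn, ← intervalIntegrable_iff_integrableOn_Ioc_of_le zero_le_one]
      exact (intervalIntegral.intervalIntegrable_rpow' (by linarith)).const_mul _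
    · refine (ae_restrict_iff' measurableSet_Ioc).2 (.of_forall fun x hx => ?_)
      have := hx.1
      exact mul_nonneg (mul_nonneg hW ha.le) (rpow_nonneg this.le _)

end LayerCake

section MomentBody

variable {E : Type*} [NormedAddCommGroup E] [InnerProductSpace ℝ E] [FiniteDimensional ℝ E]
  [MeasurableSpace E] [BorelSpace E]

theorem volume_sublevel_of_homogeneous {p : ℝ} (hp : 0 < p) {H : E → ℝ}
    (hH : ∀ (c : ℝ) y, H (c • y) = |c| ^ p * H y) {V : ℝ}
    (hV : volume {y | H y ≤ 1} = ENNReal.ofReal V) {u : ℝ} (hu : 0 < u) :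
    volume {y | H y ≤ u} = ENNReal.ofReal (V * u ^ ((finrank ℝ E : ℝ) / p)) := by
  have hc : 0 < u ^ p⁻¹ := rpow_pos_of_pos hu _
  have h1 : {y | H y ≤ u} = (u ^ p⁻¹) • {y | H y ≤ 1} := by
    ext y
    rw [Set.mem_smul_set_iff_inv_smul_mem₀ hc.ne']
    simp only [Set.mem_ofPred_eq]
    rw [hH, abs_of_pos (inv_pos.2 hc), inv_rpow hc.le, rpow_inv_rpow hu.le hp.ne', inv_mul_le_iff₀ hu,
      mul_one]
  rw [h1, Measure.addHaar_smul, hV, abs_of_pos (by positivity), ← ENNReal.ofReal_mul (by positivity)]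
  congr 1
  rw [← rpow_natCast, ← rpow_mul hu.le, mul_comm]
  congr 2
  ring

theorem absMoment_closedBall_congr (p r : ℝ) {v w : E} (h : ‖v‖ = ‖w‖) :
    absMoment p ((Metric.closedBall (0 : E) r).indicator fun _ => 1) v =
      absMoment p ((Metric.closedBall (0 : E) r).indicator fun _ => 1) w := by
  let ρ := (ℝ ∙ (v - w))ᗮ.reflection
  have hρ : MeasurePreserving ρ.toHomeomorph.toMeasurableEquiv (volume : Measure E) volume :=
    ρ.measurePreserving
  simp only [absMoment]
  rw [← hρ.integral_comp ρ.toHomeomorph.toMeasurableEquiv.measurableEmbedding]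
  congr 1 with x
  change (Metric.closedBall (0 : E) r).indicator (fun _ => 1) (ρ x) * |⟪ρ x, v⟫| ^ p = _
  have h1 : ρ x ∈ Metric.closedBall (0 : E) r ↔ x ∈ Metric.closedBall (0 : E) r := by simp
  rw [LinearIsometryEquiv.inner_map_eq_flip, Submodule.reflection_symm, Submodule.reflection_sub h]
  by_cases hx : x ∈ Metric.closedBall (0 : E) r
  · rw [Set.indicator_of_mem hx, Set.indicator_of_mem (h1.2 hx)]
  · rw [Set.indicator_of_notMem hx, Set.indicator_of_notMem (mt h1.1 hx)]

/-- The absolute moments of the ball of radius `r`. -/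
theorem absMoment_closedBall (p : ℝ) {r : ℝ} (hr : 0 < r) {e : E} (he : ‖e‖ = 1) (y : E) :
    absMoment p ((Metric.closedBall (0 : E) r).indicator fun _ => 1) y =
      absMoment p ((Metric.closedBall (0 : E) 1).indicator fun _ => 1) e *
        r ^ ((finrank ℝ E : ℝ) + p) * ‖y‖ ^ p := by
  have h1 : absMoment p ((Metric.closedBall (0 : E) r).indicator fun _ => 1) y =
      ‖y‖ ^ p * absMoment p ((Metric.closedBall (0 : E) r).indicator fun _ => 1) e := by
    rw [← abs_norm y, ← absMoment_smul]
    exact absMoment_closedBall_congr p r (by rw [norm_smul, he, mul_one, norm_eq_abs, abs_norm])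
  have h2 := Measure.integral_comp_smul (volume : Measure E)
    (fun x => (Metric.closedBall (0 : E) r).indicator (fun _ => (1 : ℝ)) x * |⟪x, e⟫| ^ p) r
  have h3 : ∀ x : E, (Metric.closedBall (0 : E) r).indicator (fun _ => (1 : ℝ)) (r • x) *
      |⟪r • x, e⟫| ^ p = r ^ p *
        ((Metric.closedBall (0 : E) 1).indicator (fun _ => (1 : ℝ)) x * |⟪x, e⟫| ^ p) := fun x => by
    rw [real_inner_smul_left, abs_mul, mul_rpow (abs_nonneg _) (abs_nonneg _), abs_of_pos hr]
    have h4 : r • x ∈ Metric.closedBall (0 : E) r ↔ x ∈ Metric.closedBall (0 : E) 1 := by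
      simp [norm_smul, abs_of_pos hr, hr]
    by_cases hx : x ∈ Metric.closedBall (0 : E) 1
    · rw [Set.indicator_of_mem hx, Set.indicator_of_mem (h4.2 hx)]
      ring
    · rw [Set.indicator_of_notMem hx, Set.indicator_of_notMem (mt h4.1 hx)]
      ring
  simp_rw [h3] at h2
  rw [integral_const_mul, smul_eq_mul, abs_of_pos (by positivity)] at h2
  change r ^ p * absMoment p ((Metric.closedBall (0 : E) 1).indicator fun _ => 1) e =
    (r ^ finrank ℝ E)⁻¹ * absMoment p ((Metric.closedBall (0 : E) r).indicator fun _ => 1) e at h2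
  rw [h1, rpow_add hr, rpow_natCast]
  field_simp at h2
  rw [← h2]
  ring

theorem lintegral_abs_rpow_mul_exp_neg_sq {p : ℝ} (hp : -1 < p) :
    ∫⁻ t : ℝ, ENNReal.ofReal (|t| ^ p * exp (-t ^ 2)) = ENNReal.ofReal (Gamma ((p + 1) / 2)) := by
  have h1 : ∫ t : ℝ, |t| ^ p * exp (-t ^ 2) = Gamma ((p + 1) / 2) := by
    have h2 := integral_comp_abs (f := fun t : ℝ => t ^ p * exp (-t ^ 2))
    simp only [sq_abs] at h2
    have h3 := integral_rpow_mul_exp_neg_rpow (p := 2) two_pos hp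
    simp only [rpow_two] at h3
    rw [h2, h3]
    ring
  rw [← h1, ofReal_integral_eq_lintegral_ofReal]
  · refine Integrable.of_integral_ne_zero ?_
    rw [h1]
    exact (Gamma_pos_of_pos (by linarith)).ne'
  · exact .of_forall fun t => by positivity

theorem lintegral_exp_neg_sq_norm (F : Type*) [NormedAddCommGroup F] [InnerProductSpace ℝ F]
    [FiniteDimensional ℝ F] [MeasurableSpace F] [BorelSpace F] :
    ∫⁻ u : F, ENNReal.ofReal (exp (-‖u‖ ^ 2)) = ENNReal.ofReal (π ^ ((finrank ℝ F : ℝ) / 2)) := by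
  have h1 := GaussianFourier.integral_rexp_neg_mul_sq_norm (V := F) one_pos
  simp only [neg_mul, one_mul, div_one] at h1
  rw [← h1, ofReal_integral_eq_lintegral_ofReal]
  · refine Integrable.of_integral_ne_zero ?_
    rw [h1]
    positivity
  · exact .of_forall fun t => by positivity

theorem absMoment_closedBall_one_mul_Gamma {p : ℝ} (hp : 0 < p) {e : E} (he : ‖e‖ = 1) :
    absMoment p ((Metric.closedBall (0 : E) 1).indicator fun _ => 1) e *
      Gamma (((finrank ℝ E : ℝ) + p) / 2 + 1) =
        π ^ (((finrank ℝ E : ℝ) - 1) / 2) * Gamma ((p + 1) / 2) := by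
  set J := absMoment p ((Metric.closedBall (0 : E) 1).indicator fun _ => 1) e with hJ
  have hJ0 : 0 ≤ J := absMoment_nonneg (Set.indicator_nonneg fun _ _ => zero_le_one) _ _
  set w : E → ℝ≥0∞ := fun x => ENNReal.ofReal (|⟪x, e⟫| ^ p)
  have hw : Measurable w := ((continuous_abs_inner_rpow hp.le e).measurable).ennreal_ofReal
  have hd : 0 < (finrank ℝ E : ℝ) + p := by positivity
  have hμ : ∀ u : ℝ, 0 < u → (volume.withDensity w) {x | ‖x‖ ≤ u} =
      ENNReal.ofReal (J * u ^ ((finrank ℝ E : ℝ) + p)) := fun u hu => by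
    have h1 : {x : E | ‖x‖ ≤ u} = Metric.closedBall 0 u := by ext; simp
    have h2 := absMoment_closedBall p hu he e
    rw [he, one_rpow, mul_one, ← hJ] at h2
    rw [h1, withDensity_apply _ measurableSet_closedBall, ← h2, absMoment,
      ← ofReal_integral_eq_lintegral_ofReal]
    · congr 1
      rw [← integral_indicator measurableSet_closedBall]
      congr 1 with x
      by_cases hx : x ∈ Metric.closedBall (0 : E) u
      · simp only [Set.indicator_of_mem hx, one_mul]
      · simp only [Set.indicator_of_notMem hx, zero_mul]
    · exact (continuous_abs_inner_rpow hp.le e).continuousOn.integrableOn_compact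
        (isCompact_closedBall 0 u)
    · exact .of_forall fun x => by positivity
  have hφ : Measurable fun u : ℝ => ENNReal.ofReal (exp (-u ^ 2)) := by fun_prop
  have h1 := lintegral_comp_of_measure_le (μ := volume.withDensity w) measurable_norm hd hJ0 hμ hφ
  have h2 : ∫⁻ u in Set.Ioi (0 : ℝ), ENNReal.ofReal (exp (-u ^ 2)) *
      ENNReal.ofReal (J * ((finrank ℝ E : ℝ) + p) * u ^ ((finrank ℝ E : ℝ) + p - 1)) =
        ENNReal.ofReal (J * Gamma (((finrank ℝ E : ℝ) + p) / 2 + 1)) := by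
    have h3 := integral_rpow_mul_exp_neg_rpow (p := 2) (q := (finrank ℝ E : ℝ) + p - 1) two_pos
      (by linarith)
    simp only [rpow_two] at h3
    have h4 := integrableOn_rpow_mul_exp_neg_rpow (p := 2) (s := (finrank ℝ E : ℝ) + p - 1)
      (by linarith) two_pos
    simp only [rpow_two] at h4
    rw [Gamma_add_one (by positivity)]
    have h5 : J * (((finrank ℝ E : ℝ) + p) / 2 * Gamma (((finrank ℝ E : ℝ) + p) / 2)) =
        ∫ u in Set.Ioi (0 : ℝ), J * ((finrank ℝ E : ℝ) + p) *
          (u ^ ((finrank ℝ E : ℝ) + p - 1) * exp (-u ^ 2)) := by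
      rw [integral_const_mul, h3, sub_add_cancel]
      ring
    rw [h5, ofReal_integral_eq_lintegral_ofReal (h4.const_mul _)]
    · refine lintegral_congr fun u => ?_
      rw [← ENNReal.ofReal_mul (by positivity)]
      congr 1
      ring
    · refine (ae_restrict_iff' measurableSet_Ioi).2 (.of_forall fun u hu => ?_)
      have : 0 < u := hu
      exact mul_nonneg (by positivity) (by positivity)
  obtain ⟨Ψ, hΨ, hΨe⟩ := exists_measurePreserving_orthogonal_coordinates e he
  have h3 : ∫⁻ x, ENNReal.ofReal (exp (-‖x‖ ^ 2)) ∂(volume.withDensity w) =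
      ENNReal.ofReal (π ^ (((finrank ℝ E : ℝ) - 1) / 2) * Gamma ((p + 1) / 2)) := by
    rw [lintegral_withDensity_eq_lintegral_mul _ hw (by fun_prop),
      ← hΨ.lintegral_comp_emb Ψ.measurableEmbedding]
    have h4 : ∀ q : (ℝ ∙ e)ᗮ × ℝ, (w * fun x : E => ENNReal.ofReal (exp (-‖x‖ ^ 2)) : E → ℝ≥0∞) (Ψ q) =
        ENNReal.ofReal (exp (-‖q.1‖ ^ 2)) * ENNReal.ofReal (|q.2| ^ p * exp (-q.2 ^ 2)) := fun q => by
      have h5 : ⟪(q.1 : E), e⟫ = 0 := Submodule.mem_orthogonal_singleton_iff_inner_left.1 q.1.2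
      have h6 : ⟪Ψ q, e⟫ = q.2 := by
        rw [hΨe, inner_add_left, real_inner_smul_left, h5, real_inner_self_eq_norm_sq, he]
        ring
      have h7 : ‖Ψ q‖ ^ 2 = ‖q.1‖ ^ 2 + q.2 ^ 2 := by
        rw [hΨe, norm_add_sq_real, inner_smul_right, h5, norm_smul, he]
        simp
      simp only [Pi.mul_apply, w]
      rw [h6, h7, ← ENNReal.ofReal_mul (by positivity), ← ENNReal.ofReal_mul (by positivity), neg_add,
        exp_add]
      congr 1
      ring
    simp_rw [h4]
    rw [Measure.volume_eq_prod, lintegral_prod_mul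
      (f := fun u : (ℝ ∙ e)ᗮ => ENNReal.ofReal (exp (-‖u‖ ^ 2)))
      (g := fun t : ℝ => ENNReal.ofReal (|t| ^ p * exp (-t ^ 2))) (by fun_prop) (by fun_prop),
      lintegral_exp_neg_sq_norm, lintegral_abs_rpow_mul_exp_neg_sq (by linarith),
      ← ENNReal.ofReal_mul (by positivity)]
    have h8 : finrank ℝ E = 1 + finrank ℝ (ℝ ∙ e)ᗮ := by
      rw [← Submodule.finrank_add_finrank_orthogonal (ℝ ∙ e),
        finrank_span_singleton (by rintro rfl; simp at he)]
    rw [h8]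
    push_cast
    rw [add_sub_cancel_left]
  have h4 := h3.symm.trans (h1.trans h2)
  have hG : 0 < Gamma ((p + 1) / 2) := Gamma_pos_of_pos (by linarith)
  have hG' : 0 < Gamma (((finrank ℝ E : ℝ) + p) / 2 + 1) := Gamma_pos_of_pos (by linarith)
  exact ((ENNReal.ofReal_eq_ofReal_iff (by positivity) (by positivity)).1 h4).symm

/-- Volume of a star body in polar coordinates. -/
theorem finrank_mul_volume_of_homogeneous [Nontrivial E] {p : ℝ} (hp : 0 < p) {H : E → ℝ}
    (hHm : Measurable H) (hH : ∀ (c : ℝ) y, H (c • y) = |c| ^ p * H y)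
    (hpos : ∀ ξ, ‖ξ‖ = 1 → 0 < H ξ) :
    (finrank ℝ E : ℝ≥0∞) * volume {y | H y < 1} =
      ∫⁻ ξ : Metric.sphere (0 : E) 1, ENNReal.ofReal (H ξ ^ (-(finrank ℝ E : ℝ) / p))
        ∂(volume : Measure E).toSphere := by
  set T : Set (Metric.sphere (0 : E) 1 × Set.Ioi (0 : ℝ)) := {q | (q.2 : ℝ) ^ p * H q.1 < 1}
  have hT : MeasurableSet T := by
    refine measurableSet_lt (Measurable.mul ?_ ?_) measurable_const
    · exact (measurable_subtype_coe.comp measurable_snd).pow_const p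
    · exact hHm.comp (measurable_subtype_coe.comp measurable_fst)
  have hmp := Measure.measurePreserving_homeomorphUnitSphereProd (volume : Measure E)
  have h1 := hmp.measure_preimage hT.nullMeasurableSet
  have h2 : homeomorphUnitSphereProd E ⁻¹' T = Subtype.val ⁻¹' {y : E | H y < 1} := by
    ext x
    have hx : (x : E) ≠ 0 := x.2
    simp only [Set.mem_preimage, Set.mem_ofPred_eq, T]
    rw [homeomorphUnitSphereProd_apply_fst_coe, homeomorphUnitSphereProd_apply_snd_coe, hH,
      abs_of_nonneg (by positivity), inv_rpow (norm_nonneg _), mul_inv_cancel_left₀]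
    exact (rpow_pos_of_pos (norm_pos_iff.2 hx) p).ne'
  rw [h2, (MeasurableEmbedding.subtype_coe (measurableSet_singleton (0 : E)).compl).comap_apply,
    Subtype.image_preimage_coe, Measure.prod_apply hT] at h1
  have h3 : volume ({0}ᶜ ∩ {y : E | H y < 1}) = volume {y : E | H y < 1} := by
    rw [Set.inter_comm, ← Set.sdiff_eq, measure_sdiff_null (measure_singleton _)]
  rw [h3] at h1
  have hd : 0 < finrank ℝ E := finrank_pos
  rw [h1, ← lintegral_const_mul' _ _ (ENNReal.natCast_ne_top _)]
  refine lintegral_congr fun ξ => ?_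
  have hξ : 0 < H ξ := hpos ξ (by simp)
  have hc : 0 < H ξ ^ (-p⁻¹) := rpow_pos_of_pos hξ _
  have h4 : Prod.mk ξ ⁻¹' T = Set.Iio ⟨H ξ ^ (-p⁻¹), hc⟩ := by
    ext r
    have hr : 0 < (r : ℝ) := r.2
    simp only [Set.mem_preimage, Set.mem_ofPred_eq, T, Set.mem_Iio]
    change (r : ℝ) ^ p * H ξ < 1 ↔ (r : ℝ) < H ξ ^ (-p⁻¹)
    rw [← lt_div_iff₀ hξ, one_div, rpow_neg hξ.le, ← inv_rpow hξ.le,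
      lt_rpow_inv_iff_of_pos hr.le (inv_pos.2 hξ).le hp]
  rw [h4, Measure.volumeIoiPow_apply_Iio, Nat.sub_add_cancel hd, Nat.cast_pred hd, sub_add_cancel,
    ← ENNReal.ofReal_natCast, ← ENNReal.ofReal_mul (by positivity)]
  congr 1
  change (finrank ℝ E : ℝ) * ((H ξ ^ (-p⁻¹)) ^ finrank ℝ E / finrank ℝ E) = _
  rw [mul_div_cancel₀ _ (by positivity), ← rpow_natCast, ← rpow_mul hξ.le]
  congr 1
  ring

end MomentBody

theorem rpow_le_of_forall_mul_le {A D M θ : ℝ} (hA : 0 < A) (hM : 0 < M) (hθ : 0 < θ)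
    (h : ∀ s, 0 < s → A * s ≤ D * s ^ (1 + θ) + M) :
    A ^ (1 + θ) ≤ (1 + θ) ^ (1 + θ) * θ ^ (-θ) * D * M ^ θ := by
  have h1 := h (M * (1 + θ) / (θ * A)) (by positivity)
  have h2 : A * (M * (1 + θ) / (θ * A)) = M / θ + M := by
    field_simp
  rw [h2, div_rpow (by positivity) (by positivity), mul_rpow hM.le (by positivity),
    mul_rpow hθ.le hA.le] at h1
  have h3 : M / θ * (θ ^ (1 + θ) * A ^ (1 + θ)) ≤ D * (M ^ (1 + θ) * (1 + θ) ^ (1 + θ)) := by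
    rw [← le_div_iff₀ (by positivity), mul_div_assoc]
    linarith
  rw [rpow_add hθ 1, rpow_add hM 1, rpow_one, rpow_one] at h3
  rw [rpow_neg hθ.le]
  have h4 : A ^ (1 + θ) * θ ^ θ ≤ D * (M ^ θ * (1 + θ) ^ (1 + θ)) := by
    refine le_of_mul_le_mul_left ?_ hM
    calc M * (A ^ (1 + θ) * θ ^ θ) = M / θ * (θ * θ ^ θ * A ^ (1 + θ)) := by field_simp
      _ ≤ _ := h3
      _ = _ := by ring
  calc A ^ (1 + θ) ≤ D * (M ^ θ * (1 + θ) ^ (1 + θ)) / θ ^ θ := by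
        rwa [le_div_iff₀ (by positivity)]
    _ = _ := by ring

section FunctionalInequality

variable {E : Type*} [NormedAddCommGroup E] [InnerProductSpace ℝ E] [FiniteDimensional ℝ E]
  [MeasurableSpace E] [BorelSpace E]

theorem absMoment_closedBall_one_pos {p : ℝ} (hp : 0 < p) {e : E} (he : ‖e‖ = 1) :
    0 < absMoment p ((Metric.closedBall (0 : E) 1).indicator fun _ => 1) e := by
  have hG : 0 < Gamma ((p + 1) / 2) := Gamma_pos_of_pos (by linarith)
  have hG' : 0 < Gamma (((finrank ℝ E : ℝ) + p) / 2 + 1) := Gamma_pos_of_pos (by positivity)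
  have h := absMoment_closedBall_one_mul_Gamma hp he
  refine pos_of_mul_pos_left ?_ hG'.le
  rw [h]
  positivity

/-- The absolute moment body of a density of mass `V` has volume at most that of the absolute
moment body of the centred ball of volume `V`. -/
theorem IsDensity.volume_absMoment_rpow_mul_le {p R : ℝ} (hp : 1 ≤ p) (hR : 0 ≤ R) {f : E → ℝ}
    (hf : IsDensity R f) (hf0 : 0 < ∫ x, f x) {e : E} (he : ‖e‖ = 1) :
    volume.real {y | absMoment p f y ≤ 1} ^ p *
        absMoment p ((Metric.closedBall (0 : E) 1).indicator fun _ => 1) e ^ (finrank ℝ E : ℝ) *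
          (∫ x, f x) ^ ((finrank ℝ E : ℝ) + p) ≤
      volume.real (Metric.ball (0 : E) 1) ^ ((finrank ℝ E : ℝ) + 2 * p) := by
  have hp0 : 0 < p := by linarith
  have : Nontrivial E := ⟨⟨e, 0, by rintro rfl; simp at he⟩⟩
  have hd : 0 < finrank ℝ E := finrank_pos
  have hd' : (0 : ℝ) < finrank ℝ E := by exact_mod_cast hd
  have hJ := absMoment_closedBall_one_pos hp0 he
  set J := absMoment p ((Metric.closedBall (0 : E) 1).indicator fun _ => 1) e
  set ω := volume.real (Metric.ball (0 : E) 1) with hω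
  set n : ℝ := (finrank ℝ E : ℝ) with hn
  set V := ∫ x, f x
  have hω0 : 0 < ω := ENNReal.toReal_pos (Metric.measure_ball_pos _ _ one_pos).ne'
    measure_ball_lt_top.ne
  set r := (V / ω) ^ n⁻¹ with hr
  have hr0 : 0 < r := by positivity
  have hrn : r ^ n = V / ω := by rw [hr, rpow_inv_rpow (by positivity) hd'.ne']
  have hrV : volume.real (Metric.closedBall (0 : E) r) = V := by
    rw [Measure.addHaar_real_closedBall _ _ hr0.le, ← rpow_natCast, ← hn, hrn, ← hω,
      div_mul_cancel₀ _ hω0.ne']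
  have h1 := hf.volume_absMoment_le hR hp hf0 hrV
  set t := (J * r ^ (n + p)) ^ (-p⁻¹) with ht
  have ht0 : 0 < t := by positivity
  have h2 : {y | absMoment p ((Metric.closedBall (0 : E) r).indicator fun _ => 1) y ≤ 1} ⊆
      Metric.closedBall 0 t := fun y hy => by
    have hy' : J * r ^ (n + p) * ‖y‖ ^ p ≤ 1 := by
      have := absMoment_closedBall p hr0 he y
      rw [← this]
      exact hy
    rw [mem_closedBall_zero_iff]
    have h3 : ‖y‖ ^ p ≤ (J * r ^ (n + p))⁻¹ := by
      rwa [← one_div, le_div_iff₀' (by positivity)]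
    rw [ht, rpow_neg (by positivity), ← inv_rpow (by positivity)]
    exact (le_rpow_inv_iff_of_pos (norm_nonneg _) (by positivity) hp0).2 h3
  have h3 : volume.real {y | absMoment p f y ≤ 1} ≤ t ^ n * ω := by
    have h4 := ENNReal.toReal_mono measure_closedBall_lt_top.ne (h1.trans (measure_mono h2))
    change volume.real _ ≤ volume.real _ at h4
    rwa [Measure.addHaar_real_closedBall _ _ ht0.le, ← rpow_natCast, ← hn] at h4
  have h4 : (t ^ n) ^ p = (J ^ n * (V / ω) ^ (n + p))⁻¹ := by
    rw [← rpow_mul ht0.le, ht, ← rpow_mul (by positivity), ← hrn, ← rpow_mul hr0.le,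
      mul_comm n (n + p), rpow_mul hr0.le, ← mul_rpow hJ.le (by positivity),
      ← rpow_neg (by positivity)]
    congr 1
    field_simp
  calc _ ≤ (t ^ n * ω) ^ p * J ^ n * V ^ (n + p) := by
        gcongr
    _ = _ := by
        rw [mul_rpow (by positivity) hω0.le, h4, div_rpow hf0.le hω0.le,
          show n + 2 * p = (n + p) + p by ring, rpow_add hω0 (n + p) p]
        field_simp

theorem integrable_uncurry_mul_abs_inner_rpow {p ρ R : ℝ} (hp : 0 < p) {f g : E → ℝ}
    (hf : Integrable f) (hg : Integrable g) (hf0 : ∀ x, ρ < ‖x‖ → f x = 0)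
    (hg0 : ∀ x, R < ‖x‖ → g x = 0) :
    Integrable (Function.uncurry fun x y => f x * g y * |⟪y, x⟫| ^ p)
      ((volume : Measure E).prod volume) := by
  have h1 := hf.mul_prod hg
  refine (h1.norm.mul_const ((R * ρ) ^ p)).mono' ?_ (.of_forall fun z => ?_)
  · have h : Continuous fun z : E × E => |⟪z.2, z.1⟫| ^ p :=
      (continuous_snd.inner continuous_fst).abs.rpow_const fun _ => Or.inr hp.le
    exact h1.aestronglyMeasurable.mul h.aestronglyMeasurable
  · change ‖f z.1 * g z.2 * |⟪z.2, z.1⟫| ^ p‖ ≤ ‖f z.1 * g z.2‖ * (R * ρ) ^ p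
    rw [norm_mul]
    rcases lt_or_ge ρ ‖z.1‖ with h | h
    · simp [hf0 _ h]
    rcases lt_or_ge R ‖z.2‖ with h' | h'
    · simp [hg0 _ h']
    have hR := (norm_nonneg _).trans h'
    rw [norm_of_nonneg (show 0 ≤ |⟪z.2, z.1⟫| ^ p by positivity)]
    gcongr
    exact (abs_real_inner_le_norm _ _).trans (by gcongr)

theorem integral_mul_absMoment_comm {p ρ R : ℝ} (hp : 0 < p) {f g : E → ℝ}
    (hf : Integrable f) (hg : Integrable g) (hf0 : ∀ x, ρ < ‖x‖ → f x = 0)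
    (hg0 : ∀ x, R < ‖x‖ → g x = 0) :
    ∫ x, f x * absMoment p g x = ∫ y, g y * absMoment p f y := by
  have h := integral_integral_swap (integrable_uncurry_mul_abs_inner_rpow hp hf hg hf0 hg0)
  simp only [absMoment, ← integral_const_mul]
  refine Eq.trans ?_ (h.trans ?_)
  · simp only [mul_assoc]
  · refine integral_congr_ae (.of_forall fun y => integral_congr_ae (.of_forall fun x => ?_))
    change f x * g y * |⟪y, x⟫| ^ p = g y * (f x * |⟪x, y⟫| ^ p)
    rw [real_inner_comm]
    ring

theorem integral_indicator_sublevel_mul {p : ℝ} (hp : 0 < p) [Nontrivial E] {H : E → ℝ}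
    (hHm : Measurable H) (hH0 : ∀ y, 0 ≤ H y)
    (hH : ∀ (c : ℝ) y, H (c • y) = |c| ^ p * H y) (hfin : volume {y | H y ≤ 1} ≠ ∞) :
    ∫ y, {y | H y ≤ 1}.indicator (fun _ => 1) y * H y =
      volume.real {y | H y ≤ 1} * (finrank ℝ E / (finrank ℝ E + p)) := by
  have hd : (0 : ℝ) < finrank ℝ E := by exact_mod_cast (finrank_pos (R := ℝ) (M := E))
  have h1 := setLIntegral_of_measure_le (μ := (volume : Measure E)) hHm
    (a := (finrank ℝ E : ℝ) / p) (W := volume.real {y | H y ≤ 1}) (by positivity)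
    measureReal_nonneg fun u hu => volume_sublevel_of_homogeneous hp hH
      (ENNReal.ofReal_toReal hfin).symm hu
  have hL : MeasurableSet {y | H y ≤ 1} := measurableSet_le hHm measurable_const
  have h2 : ∫ y, {y | H y ≤ 1}.indicator (fun _ => 1) y * H y = ∫ y in {y | H y ≤ 1}, H y := by
    rw [← integral_indicator hL]
    congr 1 with x
    by_cases hx : x ∈ {y | H y ≤ 1}
    · simp only [Set.indicator_of_mem hx, one_mul]
    · simp only [Set.indicator_of_notMem hx, zero_mul]
  rw [h2, integral_eq_lintegral_of_nonneg_ae (.of_forall hH0) hHm.aestronglyMeasurable, h1,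
    ENNReal.toReal_ofReal (by positivity)]
  congr 1
  field_simp

theorem integral_mul_sub_le {X : Type*} [MeasurableSpace X] {μ : Measure X} {q l a W s : ℝ}
    (hlq : l.HolderConjugate q) {f N : X → ℝ} (hf : MemLp f (ENNReal.ofReal l) μ)
    (hf0 : ∀ x, 0 ≤ f x) (hN : Measurable N) (hfi : Integrable f μ)
    (hfN : Integrable (fun x => f x * N x) μ) (ha : 0 < a) (hW : 0 ≤ W) (hs : 0 < s)
    (h : ∀ u, 0 < u → μ {x | N x ≤ u} = ENNReal.ofReal (W * u ^ a)) :
    (∫ x, f x ∂μ) * s - ∫ x, f x * N x ∂μ ≤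
      (∫ x, f x ^ l ∂μ) ^ (1 / l) *
        (W * (a * ProbabilityTheory.beta a (q + 1))) ^ (1 / q) * s ^ (1 + a / q) := by
  have hq : 0 < q := hlq.symm.pos
  have hβ := ProbabilityTheory.beta_pos ha (show 0 < q + 1 by linarith)
  have h1 := lintegral_sub_rpow hN ha hW hq hs h
  set g : X → ℝ := fun x => max 0 (s - N x) with hg
  have hgm : Measurable g := by fun_prop
  have hg0 : ∀ x, 0 ≤ g x := fun x => le_max_left _ _
  have hgi : Integrable (fun x => g x ^ q) μ := by
    refine ⟨(hgm.pow_const q).aestronglyMeasurable, ?_⟩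
    rw [hasFiniteIntegral_iff_ofReal (.of_forall fun x => rpow_nonneg (hg0 x) q), h1]
    exact ENNReal.ofReal_lt_top
  have hgL : MemLp g (ENNReal.ofReal q) μ := by
    rw [← integrable_norm_rpow_iff hgm.aestronglyMeasurable (by simpa using hq)
      ENNReal.ofReal_ne_top, ENNReal.toReal_ofReal hq.le]
    simpa only [norm_of_nonneg (hg0 _)] using hgi
  have h2 : ∫ x, g x ^ q ∂μ = W * (a * ProbabilityTheory.beta a (q + 1)) * s ^ (q + a) := by
    rw [integral_eq_lintegral_of_nonneg_ae (.of_forall fun x => rpow_nonneg (hg0 x) q)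
      (hgm.pow_const q).aestronglyMeasurable, h1, ENNReal.toReal_ofReal (by positivity)]
  have h3 := integral_mul_le_Lp_mul_Lq_of_nonneg hlq (.of_forall hf0) (.of_forall hg0) hf hgL
  rw [h2, mul_rpow (by positivity) (by positivity), ← rpow_mul hs.le,
    show (q + a) * (1 / q) = 1 + a / q by field_simp] at h3
  rw [mul_assoc, ← integral_mul_const, ← integral_sub (hfi.mul_const s) hfN]
  have : Fact (1 ≤ ENNReal.ofReal l) := ⟨by simpa using hlq.lt.le⟩
  have hc : (ENNReal.ofReal l).HolderConjugate (ENNReal.ofReal q) :=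
    Real.HolderConjugate.ennrealOfReal hlq
  refine (integral_mono ((hfi.mul_const s).sub hfN) (hf.integrable_mul hgL) fun x => ?_).trans h3
  change f x * s - f x * N x ≤ f x * g x
  rw [← mul_sub]
  exact mul_le_mul_of_nonneg_left (le_max_right _ _) (hf0 x)

end FunctionalInequality

section Assembly

variable {E : Type*} [NormedAddCommGroup E] [InnerProductSpace ℝ E] [FiniteDimensional ℝ E]
  [MeasurableSpace E] [BorelSpace E]

/-- The inequality between the mass of `f` and its absolute moments, with the constant expressed
through the unit ball. -/
theorem integral_rpow_le_mul_sphere_integral [Nontrivial E] {p q l : ℝ} (hp : 1 ≤ p)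
    (hlq : l.HolderConjugate q) {f : E → ℝ} (hfc : Continuous f) (hfs : HasCompactSupport f)
    (hf0 : ∀ x, 0 ≤ f x) (hfne : f ≠ 0) {e : E} (he : ‖e‖ = 1) {n a θ κ : ℝ}
    (hn : n = finrank ℝ E) (ha : a = n / p) (hθ : θ = a / q)
    (hκ : κ = a * ProbabilityTheory.beta a (q + 1)) :
    (∫ x, f x) ^ (n + q * p) ≤
      (1 + θ) ^ (n + q * p) * θ ^ (-n) * κ ^ p * volume.real (Metric.ball (0 : E) 1) ^ (n + 2 * p) *
        absMoment p ((Metric.closedBall (0 : E) 1).indicator fun _ => 1) e ^ (-n) *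
        (n / (n + p)) ^ n * n ^ p * ((∫ x, f x ^ l) ^ (1 / l)) ^ (q * p) *
        (∫ ξ : Metric.sphere (0 : E) 1, absMoment p f ξ ^ (-n / p)
          ∂(volume : Measure E).toSphere) ^ (-p) := by
  have hp0 : 0 < p := by linarith
  have hq : 0 < q := hlq.symm.pos
  have hn0 : 0 < n := by
    rw [hn]
    exact_mod_cast (finrank_pos (R := ℝ) (M := E))
  have ha0 : 0 < a := by rw [ha]; positivity
  have hθ0 : 0 < θ := by rw [hθ]; positivity
  have hκ0 : 0 < κ := by
    rw [hκ]
    exact mul_pos ha0 (ProbabilityTheory.beta_pos ha0 (by linarith))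
  have hfi : Integrable f := hfc.integrable_of_hasCompactSupport hfs
  obtain ⟨x₀, hx₀⟩ : ∃ x, f x ≠ 0 := Function.ne_iff.1 hfne
  have hA : 0 < ∫ x, f x := hfc.integral_pos_of_hasCompactSupport_nonneg_nonzero hfs hf0 hx₀
  set A := ∫ x, f x
  -- bounds on `f` and on its absolute moments
  obtain ⟨C₀, hC₀⟩ := hfc.bounded_above_of_compact_support hfs
  have hC : 0 < max C₀ 1 := by positivity
  set C := max C₀ 1
  obtain ⟨R, hR⟩ := hfs.isCompact.isBounded.subset_closedBall (0 : E)
  have hfR : ∀ x, R < ‖x‖ → f x = 0 := fun x hx => by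
    by_contra h
    exact not_le.2 hx (mem_closedBall_zero_iff.1 (hR (subset_tsupport f h)))
  set H := absMoment p f with hH
  have hHm : Measurable H := measurable_absMoment hfc.measurable p
  have hHs : ∀ (c : ℝ) y, H (c • y) = |c| ^ p * H y := absMoment_smul p f
  have hH0 : ∀ y, 0 ≤ H y := absMoment_nonneg hf0 p
  have hg : IsDensity R fun x => C⁻¹ * f x :=
    ⟨hfc.measurable.const_mul _, fun x => mul_nonneg (inv_nonneg.2 hC.le) (hf0 x), fun x => by
      rw [inv_mul_le_iff₀ hC, mul_one]
      exact (le_abs_self _).trans ((hC₀ x).trans (le_max_left _ _)), fun x hx => by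
      rw [hfR x hx, mul_zero]⟩
  obtain ⟨c, hc, hcH⟩ := IsDensity.exists_mul_norm_rpow_le_absMoment (E := E) hp0 R
    (A := C⁻¹ * A) (by positivity)
  have hHc : ∀ y, C * c * ‖y‖ ^ p ≤ H y := fun y => by
    have h1 := hcH _ hg (integral_const_mul _ _) y
    have h2 : absMoment p (fun x => C⁻¹ * f x) y = C⁻¹ * H y := by
      simp only [hH, absMoment, mul_assoc, integral_const_mul]
    rw [h2, le_inv_mul_iff₀ hC] at h1
    linarith
  have hHpos : ∀ ξ, ‖ξ‖ = 1 → 0 < H ξ := fun ξ hξ => by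
    have := hHc ξ
    rw [hξ, one_rpow, mul_one] at this
    exact (mul_pos hC hc).trans_le this
  -- the sublevel set of the moments
  set ρ := (C * c)⁻¹ ^ p⁻¹ with hρ
  have hρ0 : 0 ≤ ρ := by positivity
  have hLρ : ∀ y, H y ≤ 1 → ‖y‖ ≤ ρ := fun y hy =>
    (le_rpow_inv_iff_of_pos (norm_nonneg _) (by positivity) hp0).2
      (by simpa using (le_inv_mul_iff₀ (mul_pos hC hc)).2 ((hHc y).trans hy))
  set L := {y | H y ≤ 1} with hL
  have hLm : MeasurableSet L := measurableSet_le hHm measurable_const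
  have hLfin : volume L ≠ ∞ := ((measure_mono fun y hy =>
    mem_closedBall_zero_iff.2 (hLρ y hy)).trans_lt (measure_closedBall_lt_top (r := ρ))).ne
  set S := ∫ ξ : Metric.sphere (0 : E) 1, H ξ ^ (-n / p) ∂(volume : Measure E).toSphere with hS
  have hpolar := finrank_mul_volume_of_homogeneous hp0 hHm hHs hHpos
  rw [← hn] at hpolar
  have hSm : Measurable fun ξ : Metric.sphere (0 : E) 1 => H ξ ^ (-n / p) :=
    (hHm.comp measurable_subtype_coe).pow_const _
  have hSpos : ∀ ξ : Metric.sphere (0 : E) 1, 0 < H ξ ^ (-n / p) := fun ξ =>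
    rpow_pos_of_pos (hHpos ξ (by simp)) _
  have hSlt : ∫⁻ ξ : Metric.sphere (0 : E) 1, ENNReal.ofReal (H ξ ^ (-n / p))
      ∂(volume : Measure E).toSphere ≤ ENNReal.ofReal (n * volume.real L) := by
    rw [← hpolar, ENNReal.ofReal_mul hn0.le, hn, ENNReal.ofReal_natCast, measureReal_def,
      ENNReal.ofReal_toReal hLfin]
    gcongr
    exact fun y (hy : H y < 1) => hy.le
  have hS0 : 0 < S := by
    rw [hS, integral_pos_iff_support_of_nonneg (fun ξ => (hSpos ξ).le)]
    · rw [Set.eq_univ_of_forall (s := Function.support _) fun ξ => (hSpos ξ).ne']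
      exact pos_iff_ne_zero.2 (mt Measure.measure_univ_eq_zero.1 (Measure.toSphere_ne_zero _))
    · refine ⟨hSm.aestronglyMeasurable, ?_⟩
      rw [hasFiniteIntegral_iff_ofReal (.of_forall fun ξ => (hSpos ξ).le)]
      exact hSlt.trans_lt ENNReal.ofReal_lt_top
  have hSV : S ≤ n * volume.real L := by
    rw [hS, integral_eq_lintegral_of_nonneg_ae (.of_forall fun ξ => (hSpos ξ).le)
      hSm.aestronglyMeasurable]
    exact ENNReal.toReal_le_of_le_ofReal (by positivity) hSlt
  set V := volume.real L with hV
  have hV0 : 0 < V := pos_of_mul_pos_right (hS0.trans_le hSV) hn0.le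
  -- the moments of the sublevel set
  have hχ : IsDensity ρ (L.indicator fun _ => (1 : ℝ)) :=
    ⟨measurable_const.indicator hLm, Set.indicator_nonneg fun _ _ => zero_le_one,
      fun x => Set.indicator_le_self' (fun _ _ => zero_le_one) x, fun x hx =>
      Set.indicator_of_notMem (fun h : x ∈ L => not_le.2 hx (hLρ x h)) _⟩
  have hχV : ∫ x, L.indicator (fun _ => (1 : ℝ)) x = V := by
    rw [integral_indicator hLm]
    simp [hV]
  set N := absMoment p (L.indicator fun _ => (1 : ℝ)) with hN
  have hNm : Measurable N := measurable_absMoment hχ.measurable p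
  have hNs : ∀ (c : ℝ) y, N (c • y) = |c| ^ p * N y := absMoment_smul p _
  have hNfin : volume {y | N y ≤ 1} ≠ ∞ := by
    obtain ⟨ρ', h⟩ := IsDensity.exists_sublevel_subset_closedBall (E := E) hp0 ρ hV0
    exact ((measure_mono (h _ hχ hχV)).trans_lt measure_closedBall_lt_top).ne
  have hW := hχ.volume_absMoment_rpow_mul_le hp hρ0 (hV0.trans_eq hχV.symm) he
  rw [hχV, ← hn, ← hN] at hW
  set W := volume.real {y | N y ≤ 1} with hWdef
  have hW0 : 0 ≤ W := measureReal_nonneg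
  have hM : ∫ x, f x * N x = V * (n / (n + p)) := by
    rw [hN, integral_mul_absMoment_comm hp0 hfi hχ.integrable hfR hχ.eq_zero,
      integral_indicator_sublevel_mul hp0 hHm hH0 hHs hLfin, ← hn]
  have hM0 : 0 < V * (n / (n + p)) := by positivity
  set T := (∫ x, f x ^ l) ^ (1 / l) with hT
  have hT0 : 0 ≤ T := rpow_nonneg (integral_nonneg fun x => rpow_nonneg (hf0 x) l) _
  have hlevel : ∀ s, 0 < s → A * s ≤ T * (W * κ) ^ (1 / q) * s ^ (1 + θ) + V * (n / (n + p)) :=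
      fun s hs => by
    have h1 := integral_mul_sub_le hlq (hfc.memLp_of_hasCompactSupport hfs) hf0 hNm hfi
      (Integrable.of_integral_ne_zero (by rw [hM]; exact hM0.ne')) ha0 hW0 hs fun u hu => by
        rw [ha, hn]
        exact volume_sublevel_of_homogeneous hp0 hNs (ENNReal.ofReal_toReal hNfin).symm hu
    rw [hM, ← hκ, ← hθ] at h1
    linarith
  have hmain := rpow_le_rpow (by positivity) (rpow_le_of_forall_mul_le hA hM0 hθ0 hlevel)
    (mul_nonneg hq.le hp0.le)
  have hθn : θ * (q * p) = n := by
    rw [hθ, ha]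
    field_simp
  have hexp : (1 + θ) * (q * p) = n + q * p := by
    rw [add_mul, hθn]
    ring
  rw [← rpow_mul hA.le, mul_rpow (by positivity) (by positivity),
    mul_rpow (by positivity) (by positivity), mul_rpow (by positivity) (by positivity),
    mul_rpow hT0 (by positivity), ← rpow_mul (by positivity), ← rpow_mul hθ0.le,
    ← rpow_mul (mul_nonneg hW0 hκ0.le), ← rpow_mul hM0.le, hexp, neg_mul, hθn,
    show 1 / q * (q * p) = p by field_simp, mul_rpow hW0 hκ0.le,
    mul_rpow hV0.le (by positivity)] at hmain
  set J := absMoment p ((Metric.closedBall (0 : E) 1).indicator fun _ => 1) e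
  have hJ : 0 < J := absMoment_closedBall_one_pos hp0 he
  set ω := volume.real (Metric.ball (0 : E) 1)
  have hWV : W ^ p * V ^ n ≤ ω ^ (n + 2 * p) * J ^ (-n) * (n ^ p * S ^ (-p)) := by
    have h1 : W ^ p * V ^ n ≤ ω ^ (n + 2 * p) * J ^ (-n) * V ^ (-p) := by
      rw [rpow_neg hJ.le, rpow_neg hV0.le, ← div_eq_mul_inv, ← div_eq_mul_inv,
        le_div_iff₀ (by positivity), le_div_iff₀ (by positivity)]
      rw [rpow_add hV0] at hW
      linarith
    have h2 : V ^ (-p) ≤ n ^ p * S ^ (-p) := by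
      have h3 := rpow_le_rpow hS0.le hSV hp0.le
      rw [mul_rpow hn0.le hV0.le] at h3
      rw [rpow_neg hV0.le, rpow_neg hS0.le, ← div_eq_mul_inv, le_div_iff₀ (by positivity),
        inv_mul_le_iff₀ (by positivity)]
      linarith
    exact h1.trans (by gcongr)
  calc A ^ (n + q * p) ≤ (1 + θ) ^ (n + q * p) * θ ^ (-n) * κ ^ p * (n / (n + p)) ^ n *
        T ^ (q * p) * (W ^ p * V ^ n) := hmain.trans_eq (by ring)
    _ ≤ (1 + θ) ^ (n + q * p) * θ ^ (-n) * κ ^ p * (n / (n + p)) ^ n *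
        T ^ (q * p) * (ω ^ (n + 2 * p) * J ^ (-n) * (n ^ p * S ^ (-p))) := by gcongr
    _ = _ := by ring

end Assembly

theorem Rnp_rpow {n : ℕ} {p : ℝ} (hn : 0 < n) (hp : 0 < p) :
    (2 : ℝ) ^ (-(n : ℝ)) * Rnp n p ^ p =
      (√π ^ n / Gamma ((n : ℝ) / 2 + 1)) ^ ((n : ℝ) + 2 * p) *
        (π ^ (((n : ℝ) - 1) / 2) * Gamma ((p + 1) / 2) / Gamma (((n : ℝ) + p) / 2 + 1)) ^
          (-(n : ℝ)) := by
  have hn' : (0 : ℝ) < n := by exact_mod_cast hn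
  have h1 : ((n : ℝ) + 2) / 2 = n / 2 + 1 := by ring
  have h2 : ((n : ℝ) + p + 2) / 2 = (n + p) / 2 + 1 := by ring
  have hG1 : 0 < Gamma ((n : ℝ) / 2 + 1) := Gamma_pos_of_pos (by positivity)
  have hG2 : 0 < Gamma (((n : ℝ) + p) / 2 + 1) := Gamma_pos_of_pos (by positivity)
  have hG3 : 0 < Gamma ((p + 1) / 2) := Gamma_pos_of_pos (by positivity)
  rw [Rnp, h1, h2]
  refine log_injOn_pos (Set.mem_Ioi.2 (by positivity)) (Set.mem_Ioi.2 (by positivity)) ?_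
  simp (disch := positivity) only [log_mul, log_div, log_rpow, log_pow, log_sqrt]
  push_cast
  field_simp
  ring

theorem anpl_eq {n : ℕ} {p lam q a θ κ : ℝ} (hn : 0 < n) (hp : 0 < p) (hlam : 1 < lam)
    (hq : q = lam / (lam - 1)) (ha : a = n / p) (hθ : θ = a / q)
    (hκ : κ = a * ProbabilityTheory.beta a (q + 1)) :
    anpl n p lam = (1 + θ) ^ ((n : ℝ) + q * p) * θ ^ (-(n : ℝ)) * κ ^ p := by
  have hn' : (0 : ℝ) < n := by exact_mod_cast hn
  have hq0 : 0 < q := by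
    rw [hq]
    exact div_pos (by linarith) (by linarith)
  have ha0 : 0 < a := by rw [ha]; positivity
  have hθ0 : 0 < θ := by rw [hθ]; positivity
  have hβ := ProbabilityTheory.beta_pos ha0 hq0
  have hκ' : κ = a * ProbabilityTheory.beta a q / (1 + θ) := by
    have hG : 0 < Gamma (a + q) := Gamma_pos_of_pos (by positivity)
    rw [hκ, hθ, ProbabilityTheory.beta, ProbabilityTheory.beta, ← add_assoc,
      Gamma_add_one hq0.ne', Gamma_add_one (by positivity)]
    field_simp
    ring
  have h1 : (n : ℝ) / (q * p) = θ := by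
    rw [hθ, ha]
    field_simp
  have h2 : q * p / n = θ⁻¹ := by rw [← h1, inv_div]
  have hna : (n : ℝ) = a * p := by
    rw [ha]
    field_simp
  rw [anpl, ← hq, h1, h2, ← ha, hκ', ← ProbabilityTheory.beta]
  have h3 : θ⁻¹ + 1 = (1 + θ) / θ := by
    field_simp
  rw [h3, add_comm θ 1]
  refine log_injOn_pos (Set.mem_Ioi.2 (by positivity)) (Set.mem_Ioi.2 (by positivity)) ?_
  simp (disch := positivity) only [log_mul, log_div, log_rpow]
  rw [hna]
  ring

end BlaschkeSantalo

/-- Symmetric functional `L_p` Blaschke–Santaló inequality, case `λ ∈ (1, ∞)`. -/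
theorem functional_BS_symmetric (n : ℕ) (hn : 2 ≤ n) (p : ℝ) (hp : 1 ≤ p)
    (lam : ℝ) (hlam : 1 < lam)
    (f : EuclideanSpace ℝ (Fin n) → ℝ) (hf_cont : Continuous f)
    (hf_nonneg : ∀ x, 0 ≤ f x) (hf_supp : HasCompactSupport f) (hf_ne : f ≠ 0) :
    (∫ x, f x) ^ ((n : ℝ) + (lam / (lam - 1)) * p) ≤
      2 ^ (-(n : ℝ)) * bnpl n p lam *
        ((∫ x, |f x| ^ lam) ^ (1 / lam)) ^ ((lam / (lam - 1)) * p) *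
        (∫ ξ : Metric.sphere (0 : EuclideanSpace ℝ (Fin n)) 1,
            (∫ x, f x * |⟪x, (ξ : EuclideanSpace ℝ (Fin n))⟫| ^ p) ^ (-(n : ℝ) / p)
          ∂((volume : Measure (EuclideanSpace ℝ (Fin n))).toSphere)) ^ (-p) := by
  have hp0 : 0 < p := by linarith
  have hn0 : 0 < n := by omega
  have : Nonempty (Fin n) := ⟨⟨0, hn0⟩⟩
  have : Nontrivial (EuclideanSpace ℝ (Fin n)) := inferInstance
  have hlq : lam.HolderConjugate (lam / (lam - 1)) := Real.HolderConjugate.conjExponent hlam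
  obtain ⟨e, he⟩ : ∃ e : EuclideanSpace ℝ (Fin n), ‖e‖ = 1 := exists_norm_eq _ zero_le_one
  have hfr : Module.finrank ℝ (EuclideanSpace ℝ (Fin n)) = n := finrank_euclideanSpace_fin
  have h := integral_rpow_le_mul_sphere_integral hp hlq hf_cont hf_supp hf_nonneg hf_ne he
    (n := n) (by rw [hfr]) rfl rfl rfl
  have hω : volume.real (Metric.ball (0 : EuclideanSpace ℝ (Fin n)) 1) =
      √π ^ n / Gamma ((n : ℝ) / 2 + 1) := by
    have hG : 0 < Gamma ((n : ℝ) / 2 + 1) := Gamma_pos_of_pos (by positivity)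
    rw [measureReal_def, EuclideanSpace.volume_ball, Fintype.card_fin, ENNReal.ofReal_one, one_pow,
      one_mul, ENNReal.toReal_ofReal (by positivity)]
  have hJ := absMoment_closedBall_one_mul_Gamma hp0 he
  rw [hfr, ← eq_div_iff (Gamma_pos_of_pos (by positivity)).ne'] at hJ
  have hR := Rnp_rpow hn0 hp0
  rw [← hω, ← hJ] at hR
  have ha := anpl_eq hn0 hp0 hlam rfl rfl rfl rfl
  simp_rw [abs_of_nonneg (hf_nonneg _)]
  refine h.trans_eq ?_
  rw [mul_assoc _ (volume.real (Metric.ball _ _) ^ _) _, ← hR, ← ha, bnpl]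
  simp only [absMoment]
  ring
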